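/- arXiv:1609.00830 — 2 statements merged into one kernel-verified Lean document; each statement's English description precedes it below -/
import Mathlib

section
/- Let Δ₁ be a Cohen-Macaulay simplicial complex of dimension r₁ − 1 and let Δ₂ be a CM_t simplicial complex for some t ≥ 1, on disjoint vertex sets. Then the join Δ₁ ∗ Δ₂ is CM_{r₁+t}. Moreover this is sharp: if Δ₂ is strictly CM_t, then Δ₁ ∗ Δ₂ is strictly CM_{r₁+t}. -/
open Finset

/-- An abstract simplicial complex on the vertex type `V`: a collection of
finite subsets of `V` (the faces) closed under passing to subsets. -/
structure SComplex (V : Type*) where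
  faces : Set (Finset V)
  down_closed : ∀ ⦃F G : Finset V⦄, F ∈ faces → G ⊆ F → G ∈ faces

namespace SComplex

variable {V : Type*} [DecidableEq V]

/-- The vertex set of a simplicial complex. -/
def vertexSet (Δ : SComplex V) : Set V := {v | {v} ∈ Δ.faces}

/-- A facet is a maximal face. -/
def IsFacet (Δ : SComplex V) (F : Finset V) : Prop :=
  F ∈ Δ.faces ∧ ∀ G ∈ Δ.faces, F ⊆ G → F = G

/-- A complex is pure if all of its facets have the same dimension (cardinality). -/
def Pure (Δ : SComplex V) : Prop :=
  ∀ ⦃F G⦄, Δ.IsFacet F → Δ.IsFacet G → F.card = G.card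

/-- One more than the dimension: the largest cardinality of a face of `Δ`.
So `Δ.dimSucc = d` means `Δ` has dimension `d - 1`. -/
noncomputable def dimSucc (Δ : SComplex V) : ℕ :=
  sSup {n | ∃ F ∈ Δ.faces, F.card = n}

/-- The link of a face `F` : `link Δ F = {G ∈ Δ : G ∪ F ∈ Δ, G ∩ F = ∅}`. -/
def link (Δ : SComplex V) (F : Finset V) : SComplex V where
  faces := {G | G ∈ Δ.faces ∧ Disjoint G F ∧ G ∪ F ∈ Δ.faces}
  down_closed := by
    rintro G H ⟨hG, hdis, hGF⟩ hHG
    exact ⟨Δ.down_closed hG hHG, Finset.disjoint_of_subset_left hHG hdis,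
      Δ.down_closed hGF (Finset.union_subset_union_left hHG)⟩

/-- A complex is connected if it has a vertex and any two vertices are joined
by a path of edges (connectivity of the 1-skeleton). -/
def Connected (Δ : SComplex V) : Prop :=
  (∃ v, {v} ∈ Δ.faces) ∧
    ∀ a b : V, {a} ∈ Δ.faces → {b} ∈ Δ.faces →
      Relation.ReflTransGen (fun x y => x ≠ y ∧ ({x, y} : Finset V) ∈ Δ.faces) a b

/-- The join of two simplicial complexes (on disjoint vertex sets):
`Δ₁ ∗ Δ₂ = {F ∪ G : F ∈ Δ₁, G ∈ Δ₂}`. -/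
def join (Δ₁ Δ₂ : SComplex V) : SComplex V where
  faces := {H | ∃ F ∈ Δ₁.faces, ∃ G ∈ Δ₂.faces, H = F ∪ G}
  down_closed := by
    rintro H H' ⟨F, hF, G, hG, rfl⟩ hsub
    refine ⟨H' ∩ F, Δ₁.down_closed hF inter_subset_right,
      H' \ F, Δ₂.down_closed hG ?_, ?_⟩
    · intro x hx
      rcases Finset.mem_sdiff.mp hx with ⟨hx1, hx2⟩
      rcases Finset.mem_union.mp (hsub hx1) with h | h
      · exact absurd h hx2
      · exact h
    · ext x
      by_cases hx : x ∈ F <;>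
        simp only [Finset.mem_union, Finset.mem_inter, Finset.mem_sdiff, hx] <;> tauto

/-- The full simplex on a finite vertex set `W`. -/
def simplexOn (W : Finset V) : SComplex V :=
  ⟨{F | F ⊆ W}, fun _ _ hF hG => hG.trans hF⟩

/-- A shelling of `Δ`: an ordering `l` of all the facets of `Δ` such that each
facet meets the union of the previous ones in a nonempty union of
codimension-one faces of it. -/
def IsShelling (Δ : SComplex V) (l : List (Finset V)) : Prop :=
  l.Nodup ∧ (∀ F, F ∈ l ↔ Δ.IsFacet F) ∧
    ∀ i j : ℕ, j < i → i < l.length →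
      ∃ m, m < i ∧ ∃ v ∈ l[i]!,
        l[i]! ∩ l[j]! ⊆ l[i]! ∩ l[m]! ∧ l[i]! ∩ l[m]! = l[i]!.erase v

/-- A complex is shellable if its facets admit a shelling order. -/
def Shellable (Δ : SComplex V) : Prop := ∃ l, IsShelling Δ l

/-- The reduced homology `H̃₀(Δ; k)` vanishes: every `k`-linear combination of
vertices of `Δ` with coefficient sum zero is a `k`-linear combination of
boundaries of edges of `Δ`. -/
def ReducedH0Vanishes (k : Type*) [Field k] (Δ : SComplex V) : Prop :=
  ∀ f : V →₀ k, (∀ v ∈ f.support, {v} ∈ Δ.faces) → (f.sum fun _ c => c) = 0 →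
    f ∈ Submodule.span k {g : V →₀ k | ∃ a b : V, a ≠ b ∧ ({a, b} : Finset V) ∈ Δ.faces ∧
      g = Finsupp.single a 1 - Finsupp.single b 1}

end SComplex

/-- A commutative ring satisfies Serre's condition `S₂` if for every prime `p`
the localization at `p` contains, inside its maximal ideal, a regular sequence
of length at least `min 2 (dim R_p)`. -/
def RingSerreS2 (R : Type*) [CommRing R] : Prop :=
  ∀ (p : Ideal R) [p.IsPrime],
    ∃ rs : List (Localization.AtPrime p),
      (∀ r ∈ rs, r ∈ IsLocalRing.maximalIdeal (Localization.AtPrime p)) ∧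
      RingTheory.Sequence.IsRegular (Localization.AtPrime p) rs ∧
      min 2 (ringKrullDim (Localization.AtPrime p)) ≤ (rs.length : WithBot ℕ∞)

section RingSide

/-- The squarefree monomial `∏_{i ∈ F} xᵢ`. -/
noncomputable def faceMonomial (k : Type*) [CommRing k] {V : Type*} (F : Finset V) :
    MvPolynomial V k :=
  ∏ i ∈ F, MvPolynomial.X i

/-- The Stanley–Reisner ideal of a complex `Δ` on the vertex type `V`:
the ideal generated by the squarefree monomials corresponding to non-faces. -/
noncomputable def srIdeal (k : Type*) [CommRing k] {V : Type*} (Δ : SComplex V) :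
    Ideal (MvPolynomial V k) :=
  Ideal.span {p | ∃ F : Finset V, F ∉ Δ.faces ∧ p = faceMonomial k F}

/-- The Stanley–Reisner ring `k[Δ]`. -/
abbrev srRing (k : Type*) [CommRing k] {V : Type*} (Δ : SComplex V) :=
  MvPolynomial V k ⧸ srIdeal k Δ

/-- The irrelevant maximal ideal of the Stanley–Reisner ring `k[Δ]`. -/
noncomputable def srIrrelevant (k : Type*) [CommRing k] {V : Type*} (Δ : SComplex V) :
    Ideal (srRing k Δ) :=
  (Ideal.span (Set.range (MvPolynomial.X : V → MvPolynomial V k))).map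
    (Ideal.Quotient.mk (srIdeal k Δ))

/-- `Δ` is Cohen–Macaulay over the field `k`: the Stanley–Reisner ring `k[Δ]`
admits a regular sequence, inside the irrelevant maximal ideal, whose length
equals the Krull dimension of `k[Δ]`. -/
def SComplex.IsCM (k : Type*) [Field k] {V : Type*} (Δ : SComplex V) : Prop :=
  ∃ rs : List (srRing k Δ), (∀ r ∈ rs, r ∈ srIrrelevant k Δ) ∧
    RingTheory.Sequence.IsRegular (srRing k Δ) rs ∧
    ringKrullDim (srRing k Δ) = (rs.length : WithBot ℕ∞)

/-- `Δ` is `CM_t` (Cohen–Macaulay in codimension `t`) over `k`: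
`Δ` is pure and `link_Δ(F)` is Cohen–Macaulay over `k` for every face `F`
with `#F ≥ t`. -/
def SComplex.IsCMt (k : Type*) [Field k] {V : Type*} [DecidableEq V] (t : ℕ)
    (Δ : SComplex V) : Prop :=
  Δ.Pure ∧ ∀ F ∈ Δ.faces, t ≤ F.card → (Δ.link F).IsCM k

end RingSide

open RingTheory.Sequence Pointwise MvPolynomial TensorProduct

universe u

section RegularSequence

open CategoryTheory Abelian

/-- Quotienting by an `M`-regular element of `I` drops the maximal length of a regular sequence in
`I` by at most one. -/
theorem exists_isRegular_quotSMulTop {R M : Type u} [CommRing R] [IsNoetherianRing R]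
    [AddCommGroup M] [Module R M] [Module.Finite R M] {I : Ideal R} {n : ℕ}
    (hI : I • (⊤ : Submodule R M) < ⊤)
    (h : ∃ rs : List R, rs.length = n + 1 ∧ (∀ r ∈ rs, r ∈ I) ∧ IsRegular M rs)
    {y : R} (hy : y ∈ I) (hreg : IsSMulRegular M y) :
    I • (⊤ : Submodule R (QuotSMulTop y M)) < ⊤ ∧
    ∃ rs : List R, rs.length = n ∧ (∀ r ∈ rs, r ∈ I) ∧ IsRegular (QuotSMulTop y M) rs := by
  have hlt : I • (⊤ : Submodule R (QuotSMulTop y M)) < ⊤ := by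
    refine lt_top_iff_ne_top.mpr fun eq => ?_
    absurd congrArg (Submodule.comap (Submodule.mkQ _)) eq
    simpa [Submodule.comap_smul_top_of_surjective I _ (Submodule.mkQ_surjective _),
      Submodule.smul_mono_left ((Ideal.span_singleton_le_iff_mem I).mpr hy),
      ← Submodule.ideal_span_singleton_smul] using hI.ne
  refine ⟨hlt, ?_⟩
  have h₁ := ((ModuleCat.exists_isRegular_tfae I (n + 1) (ModuleCat.of R M) hI).out 3 1).mp h
  refine ((ModuleCat.exists_isRegular_tfae I n (ModuleCat.of R (QuotSMulTop y M)) hlt).out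
    1 3).mp fun i hi => ?_
  have zero1 := AddCommGrpCat.isZero_of_iff_subsingleton.mpr (h₁ i (by omega))
  have zero2 := AddCommGrpCat.isZero_of_iff_subsingleton.mpr (h₁ (i + 1) (by omega))
  exact AddCommGrpCat.subsingleton_of_isZero <| ShortComplex.Exact.isZero_of_both_zeros
    ((Ext.covariant_sequence_exact₃' _
      (IsSMulRegular.smulShortComplex_shortExact (M := ModuleCat.of R M) hreg)) i (i + 1) rfl)
    (zero1.eq_zero_of_src _) (zero2.eq_zero_of_tgt _)

/-- If `I` lies in the radical of the extension of `I'` along `φ`, then a regular sequence in `I`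
can be replaced by one of the same length coming from `I'`. -/
theorem exists_isWeaklyRegular_map {R' R M : Type u} [CommRing R'] [CommRing R]
    [IsNoetherianRing R] [AddCommGroup M] [Module R M] [Module.Finite R M] (φ : R' →+* R)
    {I' : Ideal R'} {I : Ideal R} (hφ : I' ≤ I.comap φ) (hrad : I ≤ (I'.map φ).radical) {n : ℕ}
    (hI : I • (⊤ : Submodule R M) < ⊤)
    (h : ∃ rs : List R, rs.length = n ∧ (∀ r ∈ rs, r ∈ I) ∧ IsRegular M rs) :
    ∃ rs : List R', rs.length = n ∧ (∀ r ∈ rs, r ∈ I') ∧ IsWeaklyRegular M (rs.map φ) := by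
  induction n generalizing M with
  | zero => exact ⟨[], by simp⟩
  | succ n ih =>
    obtain ⟨y, hyI, hy⟩ : ∃ y ∈ I', IsSMulRegular M (φ y) := by
      by_contra! hcon
      obtain ⟨rs, hlen, hmem, hreg⟩ := h
      obtain ⟨r, rs, rfl⟩ := List.exists_cons_of_length_eq_add_one hlen
      have : ∃ p ∈ associatedPrimes R M, I' ≤ p.comap φ := by
        refine (Ideal.subset_union_prime_finite (associatedPrimes.finite R M) ⊤ ⊤
          (f := fun p => p.comap φ) ?_).mp ?_
        · intro p hp _ _
          have := IsAssociatedPrime.isPrime hp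
          exact Ideal.comap_isPrime φ p
        · intro x hx
          have := hcon x hx
          have h' : φ x ∈ ⋃ p ∈ associatedPrimes R M, (p : Set R) := by
            rw [biUnion_associatedPrimes_eq_compl_regular R M]
            exact this
          simpa using h'
      obtain ⟨p, hp, hle⟩ := this
      have hprime := IsAssociatedPrime.isPrime hp
      have hIp : I ≤ p := hrad.trans (hprime.radical_le_iff.mpr (Ideal.map_le_iff_le_comap.mpr hle))
      have hrp : r ∈ ⋃ p ∈ associatedPrimes R M, (p : Set R) :=
        Set.mem_biUnion hp (hIp (hmem r (by simp)))
      rw [biUnion_associatedPrimes_eq_compl_regular R M] at hrp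
      exact hrp ((isRegular_cons_iff M r rs).mp hreg).1
    obtain ⟨hI', h'⟩ := exists_isRegular_quotSMulTop hI h (hφ hyI) hy
    obtain ⟨rs, hlen, hmem, hreg⟩ := ih hI' h'
    exact ⟨y :: rs, by simp [hlen], by simpa using ⟨hyI, hmem⟩, by
      simpa using hreg.cons hy⟩

/-- If `N` is a retract of `M`, semilinearly over `φ`, then weak regularity descends from `M`
to `N`. -/
theorem isWeaklyRegular_of_retract {R' R N M : Type*} [CommRing R'] [CommRing R]
    [AddCommGroup N] [Module R' N] [AddCommGroup M] [Module R M] (φ : R' →+* R)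
    (ι : N →ₛₗ[φ] M) (π : M →+ N) (hπ : ∀ r m, π (φ r • m) = r • π m)
    (hπι : ∀ x, π (ι x) = x) {rs : List R'} (h : IsWeaklyRegular M (rs.map φ)) :
    IsWeaklyRegular N rs := by
  have hι (J : Ideal R') : ∀ x ∈ J • (⊤ : Submodule R' N),
      ι x ∈ J.map φ • (⊤ : Submodule R M) := fun x hx => by
    induction hx using Submodule.smul_induction_on' with
    | smul r hr n _ =>
      rw [map_smulₛₗ]
      exact Submodule.smul_mem_smul (Ideal.mem_map_of_mem φ hr) trivial
    | add x _ y _ hx hy => rw [map_add]; exact add_mem hx hy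
  have hπ' (J : Ideal R') : ∀ x ∈ J.map φ • (⊤ : Submodule R M),
      π x ∈ J • (⊤ : Submodule R' N) := fun x hx => by
    induction hx using Submodule.smul_induction_on' with
    | smul r hr m _ =>
      induction hr using Submodule.span_induction generalizing m with
      | mem r hr =>
        obtain ⟨s, hs, rfl⟩ := hr
        rw [hπ]
        exact Submodule.smul_mem_smul hs trivial
      | zero => simp
      | add r s _ _ hr hs => rw [add_smul, map_add]; exact add_mem (hr m trivial) (hs m trivial)
      | smul a r _ hr => rw [smul_eq_mul, mul_comm, mul_smul]; exact hr (a • m) trivial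
    | add x _ y _ hx hy => rw [map_add]; exact add_mem hx hy
  rw [isWeaklyRegular_iff] at h ⊢
  intro i hi
  have := h i (by simpa using hi)
  rw [isSMulRegular_quotient_iff_mem_of_smul_mem] at this ⊢
  intro x hx
  rw [← hπι x]
  refine hπ' _ _ ?_
  rw [Ideal.map_ofList, List.map_take]
  refine this _ ?_
  have := hι _ _ hx
  simpa [map_smulₛₗ, Ideal.map_ofList, List.map_take] using this

end RegularSequence

theorem faceMonomial_eq_monomial (k : Type*) [CommRing k] {V : Type*} (F : Finset V) :
    faceMonomial k F = monomial (∑ i ∈ F, Finsupp.single i 1) 1 := by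
  simp [faceMonomial, monomial_sum_one, X]

theorem sum_single_one_le_iff {V : Type*} (F : Finset V) (a : V →₀ ℕ) :
    ∑ i ∈ F, Finsupp.single i 1 ≤ a ↔ F ⊆ a.support := by
  classical
  have h (j : V) : (∑ i ∈ F, Finsupp.single i 1 : V →₀ ℕ) j = if j ∈ F then 1 else 0 := by
    simp [Finsupp.finsetSum_apply, Finsupp.single_apply]
  refine ⟨fun hle j hj => ?_, fun hsub j => ?_⟩
  · have := hle j
    rw [h, if_pos hj] at this
    simp; omega
  · rw [h]
    split_ifs with hj
    · have := hsub hj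
      simp at this; omega
    · exact Nat.zero_le _

theorem mem_srIdeal_iff {k : Type*} [CommRing k] {V : Type*} {Δ : SComplex V}
    {p : MvPolynomial V k} :
    p ∈ srIdeal k Δ ↔ ∀ a ∈ p.support, a.support ∉ Δ.faces := by
  have : {p : MvPolynomial V k | ∃ F : Finset V, F ∉ Δ.faces ∧ p = faceMonomial k F} =
      (fun a => monomial a (1 : k)) ''
        ((fun F : Finset V => ∑ i ∈ F, Finsupp.single i 1) '' {F | F ∉ Δ.faces}) := by
    ext p
    simp [faceMonomial_eq_monomial, eq_comm]
  rw [srIdeal, this, mem_ideal_span_monomial_image]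
  refine forall₂_congr fun a _ => ?_
  simp only [Set.mem_image, Set.mem_ofPred_eq, exists_exists_and_eq_and, sum_single_one_le_iff]
  exact ⟨fun ⟨F, hF, hsub⟩ ha => hF (Δ.down_closed ha hsub), fun ha => ⟨_, ha, subset_rfl⟩⟩

theorem faceMonomial_mem_srIdeal (k : Type*) [CommRing k] {V : Type*} {Δ : SComplex V}
    {F : Finset V} (hF : F ∉ Δ.faces) : faceMonomial k F ∈ srIdeal k Δ :=
  Ideal.subset_span ⟨F, hF, rfl⟩

theorem srIdeal_le_iff {k : Type*} [CommRing k] {V : Type*} {Δ : SComplex V}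
    {I : Ideal (MvPolynomial V k)} :
    srIdeal k Δ ≤ I ↔ ∀ F ∉ Δ.faces, faceMonomial k F ∈ I := by
  rw [srIdeal, Ideal.span_le]
  exact ⟨fun h F hF => h ⟨F, hF, rfl⟩, by rintro h _ ⟨F, hF, rfl⟩; exact h F hF⟩

section Irrelevant

variable {k : Type*} [CommRing k] {V : Type*} {Δ : SComplex V}

theorem srIrrelevant_ne_top [Nontrivial k] (h : ∅ ∈ Δ.faces) : srIrrelevant k Δ ≠ ⊤ := by
  let f : srRing k Δ →+* k := Ideal.Quotient.lift _ constantCoeff <| by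
    intro p hp
    by_contra hne
    refine mem_srIdeal_iff.mp hp 0 ?_ (by simpa using h)
    simpa [constantCoeff_eq] using hne
  have hle : srIrrelevant k Δ ≤ RingHom.ker f := by
    rw [srIrrelevant, Ideal.map_le_iff_le_comap, Ideal.span_le]
    rintro _ ⟨i, rfl⟩
    simp [f, RingHom.mem_ker]
  intro htop
  exact RingHom.ker_ne_top f (top_le_iff.mp (htop ▸ hle))

theorem smul_top_srRing :
    Ideal.span (Set.range (X : V → MvPolynomial V k)) •
        (⊤ : Submodule (MvPolynomial V k) (srRing k Δ)) =
      (srIrrelevant k Δ).restrictScalars (MvPolynomial V k) :=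
  Ideal.smul_top_eq_map _

theorem smul_top_srRing_lt_top [Nontrivial k] (h : ∅ ∈ Δ.faces) :
    Ideal.span (Set.range (X : V → MvPolynomial V k)) •
        (⊤ : Submodule (MvPolynomial V k) (srRing k Δ)) < ⊤ := by
  rw [smul_top_srRing, lt_top_iff_ne_top, Ne, Submodule.restrictScalars_eq_top_iff]
  exact srIrrelevant_ne_top h

end Irrelevant

theorem empty_mem_faces_of_nontrivial {k : Type*} [CommRing k] {V : Type*} {Δ : SComplex V}
    [Nontrivial (srRing k Δ)] : ∅ ∈ Δ.faces := by
  by_contra h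
  have := faceMonomial_mem_srIdeal k h
  rw [faceMonomial, prod_empty, ← Ideal.eq_top_iff_one] at this
  exact Ideal.Quotient.nontrivial_iff.mp inferInstance this

namespace SComplex

theorem eq_of_mem_iff {V : Type*} {Δ₁ Δ₂ : SComplex V}
    (h : ∀ F, F ∈ Δ₁.faces ↔ F ∈ Δ₂.faces) : Δ₁ = Δ₂ := by
  cases Δ₁; cases Δ₂
  congr
  exact Set.ext h

/-- The irrelevant ideal contains a regular sequence of length `n` on the Stanley–Reisner ring, that
is, `k[Δ]` is nontrivial and has depth at least `n`. -/
def DepthGE (k : Type*) [Field k] {V : Type*} (Δ : SComplex V) (n : ℕ) : Prop :=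
  ∃ rs : List (MvPolynomial V k), rs.length = n ∧
    (∀ r ∈ rs, r ∈ Ideal.span (Set.range X)) ∧ IsRegular (srRing k Δ) rs

theorem DepthGE.of_isWeaklyRegular {k : Type*} [Field k] {V : Type*} {Δ : SComplex V}
    (h : ∅ ∈ Δ.faces) (rs : List (MvPolynomial V k))
    (hmem : ∀ r ∈ rs, r ∈ Ideal.span (Set.range X)) (hrs : IsWeaklyRegular (srRing k Δ) rs) :
    Δ.DepthGE k rs.length := by
  refine ⟨rs, rfl, hmem, hrs, fun htop => ?_⟩
  have hle : Ideal.ofList rs ≤ Ideal.span (Set.range (X : V → MvPolynomial V k)) :=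
    Ideal.span_le.mpr hmem
  have hle' : Ideal.ofList rs • (⊤ : Submodule (MvPolynomial V k) (srRing k Δ)) ≤
      Ideal.span (Set.range (X : V → MvPolynomial V k)) • ⊤ := Submodule.smul_mono_left hle
  exact (smul_top_srRing_lt_top h).not_ge (htop.trans_le hle')

theorem DepthGE.empty_mem {k : Type*} [Field k] {V : Type*} {Δ : SComplex V} {n : ℕ}
    (h : Δ.DepthGE k n) : ∅ ∈ Δ.faces := by
  obtain ⟨rs, -, -, hrs⟩ := h
  have := hrs.nontrivial
  exact empty_mem_faces_of_nontrivial (k := k)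

theorem DepthGE.of_isWeaklyRegular_srRing {k : Type*} [Field k] {V : Type*} {Δ : SComplex V}
    (h : ∅ ∈ Δ.faces) (rs : List (srRing k Δ)) (hmem : ∀ r ∈ rs, r ∈ srIrrelevant k Δ)
    (hrs : IsWeaklyRegular (srRing k Δ) rs) : Δ.DepthGE k rs.length := by
  have hlift : ∃ rs' : List (MvPolynomial V k), rs'.map (algebraMap _ (srRing k Δ)) = rs ∧
      ∀ r ∈ rs', r ∈ Ideal.span (Set.range X) := by
    clear hrs
    induction rs with
    | nil => exact ⟨[], by simp⟩
    | cons r rs ih =>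
      obtain ⟨rs', h₁, h₂⟩ := ih fun r hr => hmem r (by simp [hr])
      obtain ⟨r', hr', hr⟩ := (Ideal.mem_map_iff_of_surjective _
        Ideal.Quotient.mk_surjective).mp (hmem r (by simp))
      exact ⟨r' :: rs', by simpa using ⟨hr, h₁⟩, by simpa using ⟨hr', h₂⟩⟩
  obtain ⟨rs', rfl, hmem'⟩ := hlift
  simpa using DepthGE.of_isWeaklyRegular h rs' hmem'
    ((isWeaklyRegular_map_algebraMap_iff _ _ _).mp hrs)

theorem depthGE_iff {k : Type*} [Field k] {V : Type*} {Δ : SComplex V} {n : ℕ} :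
    Δ.DepthGE k n ↔ ∃ rs : List (srRing k Δ), rs.length = n ∧
      (∀ r ∈ rs, r ∈ srIrrelevant k Δ) ∧ IsRegular (srRing k Δ) rs := by
  constructor
  · intro h
    have h0 := h.empty_mem
    obtain ⟨rs, rfl, hmem, hrs⟩ := h
    have hmem' : ∀ r ∈ rs.map (algebraMap _ (srRing k Δ)), r ∈ srIrrelevant k Δ := by
      simp only [List.mem_map]
      rintro _ ⟨r, hr, rfl⟩
      exact Ideal.mem_map_of_mem _ (hmem r hr)
    refine ⟨rs.map (algebraMap _ _), by simp, hmem',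
      (isWeaklyRegular_map_algebraMap_iff _ _ _).mpr hrs.1, fun htop => ?_⟩
    refine srIrrelevant_ne_top (k := k) h0 (top_le_iff.mp ?_)
    rw [smul_eq_mul, Ideal.mul_top] at htop
    rw [htop]
    exact Ideal.span_le.mpr hmem'
  · rintro ⟨rs, rfl, hmem, hrs⟩
    have := hrs.nontrivial
    exact DepthGE.of_isWeaklyRegular_srRing (empty_mem_faces_of_nontrivial (k := k)) rs hmem hrs.1

section Dim

variable {V : Type*} [Fintype V] {Δ : SComplex V}

theorem card_le_dimSucc {F : Finset V} (hF : F ∈ Δ.faces) : F.card ≤ Δ.dimSucc :=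
  le_csSup ⟨Fintype.card V, by rintro _ ⟨G, -, rfl⟩; exact card_le_univ G⟩ ⟨F, hF, rfl⟩

theorem exists_card_eq_dimSucc (h : ∅ ∈ Δ.faces) : ∃ F ∈ Δ.faces, F.card = Δ.dimSucc :=
  Nat.sSup_mem (s := {n | ∃ F ∈ Δ.faces, F.card = n}) ⟨_, ∅, h, rfl⟩
    ⟨Fintype.card V, by rintro _ ⟨G, -, rfl⟩; exact card_le_univ G⟩

theorem dimSucc_eq {n : ℕ} (hle : ∀ F ∈ Δ.faces, F.card ≤ n) (h : ∃ F ∈ Δ.faces, F.card = n) :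
    Δ.dimSucc = n := by
  obtain ⟨F, hF, rfl⟩ := h
  obtain ⟨G, hG, hGc⟩ := exists_card_eq_dimSucc (Δ.down_closed hF (empty_subset F))
  exact le_antisymm (hGc ▸ hle G hG) (card_le_dimSucc hF)

theorem exists_isFacet_superset {F : Finset V} (hF : F ∈ Δ.faces) :
    ∃ G, Δ.IsFacet G ∧ F ⊆ G := by
  obtain ⟨G, hFG, hG⟩ := (Set.toFinite Δ.faces).exists_le_maximal hF
  exact ⟨G, ⟨hG.prop, fun H hH hle => le_antisymm hle (hG.le_of_ge hH hle)⟩, hFG⟩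

open Classical in
/-- The Krull dimension of `k[Δ]` is `dim Δ + 1`. -/
theorem ringKrullDim_srRing (k : Type*) [Field k] (h : ∅ ∈ Δ.faces) :
    ringKrullDim (srRing k Δ) = Δ.dimSucc := by
  have hdim (F : Finset V) : ringKrullDim (MvPolynomial F k) = F.card := by simp
  let f (F : Finset V) : MvPolynomial V k →ₐ[k] MvPolynomial F k :=
    aeval fun i => if hi : i ∈ F then X ⟨i, hi⟩ else 0
  have hf (F : Finset V) : Function.Surjective (f F) := by
    rw [← AlgHom.range_eq_top, ← top_le_iff, ← adjoin_range_X, Algebra.adjoin_le_iff]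
    rintro _ ⟨⟨i, hi⟩, rfl⟩
    exact ⟨X i, by simp [f, hi]⟩
  apply le_antisymm
  · rw [ringKrullDim_quotient]
    refine iSup_le fun l => ?_
    let P : Ideal (MvPolynomial V k) := l.head.1.asIdeal
    let F : Finset V := univ.filter fun i => X i ∉ P
    have hF : F ∈ Δ.faces := by
      by_contra hF
      have : faceMonomial k F ∈ P := l.head.2 (faceMonomial_mem_srIdeal k hF)
      rw [faceMonomial, Ideal.IsPrime.prod_mem_iff] at this
      obtain ⟨i, hi, hi'⟩ := this
      exact (mem_filter.mp hi).2 hi'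
    let g : MvPolynomial F k →ₐ[k] MvPolynomial V k ⧸ P :=
      aeval fun i => Ideal.Quotient.mk P (X i.1)
    have hg : Function.Surjective g := by
      have hcomp : g.comp (f F) = Ideal.Quotient.mkₐ k P := by
        ext i
        by_cases hi : i ∈ F
        · simp [f, g, hi]
        · have : X i ∈ P := by simpa [F] using hi
          simp [f, hi, Ideal.Quotient.eq_zero_iff_mem.mpr this]
      have : Function.Surjective (g.comp (f F)) := hcomp ▸ Ideal.Quotient.mkₐ_surjective k P
      exact Function.Surjective.of_comp this
    have h1 := ringKrullDim_le_of_surjective g.toRingHom hg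
    rw [hdim, ringKrullDim_quotient] at h1
    have h2 : (l.length : WithBot ℕ∞) ≤
        Order.krullDim (PrimeSpectrum.zeroLocus (P : Set (MvPolynomial V k))) := by
      let l' : LTSeries (PrimeSpectrum.zeroLocus (P : Set (MvPolynomial V k))) :=
        { length := l.length
          toFun := fun i => ⟨(l i).1, LTSeries.head_le l i⟩
          step := fun i => l.step i }
      exact Order.LTSeries.length_le_krullDim l'
    exact h2.trans (h1.trans (by exact_mod_cast card_le_dimSucc hF))
  · obtain ⟨F, hF, hFc⟩ := exists_card_eq_dimSucc h
    rw [← hFc, ← hdim F]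
    refine ringKrullDim_le_of_surjective (Ideal.Quotient.lift (srIdeal k Δ) (f F).toRingHom ?_)
      (Ideal.Quotient.lift_surjective_of_surjective _ _ (hf F))
    intro p hp
    refine (srIdeal_le_iff (I := RingHom.ker (f F).toRingHom)).mpr (fun G hG => ?_) hp
    obtain ⟨i, hi, hiF⟩ := not_subset.mp fun hsub => hG (Δ.down_closed hF hsub)
    rw [RingHom.mem_ker, faceMonomial, map_prod]
    exact prod_eq_zero hi (by simp [f, hiF])

theorem isCM_iff {k : Type*} [Field k] : Δ.IsCM k ↔ Δ.DepthGE k Δ.dimSucc := by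
  rw [depthGE_iff]
  constructor
  · rintro ⟨rs, hmem, hrs, hdim⟩
    have := hrs.nontrivial
    rw [ringKrullDim_srRing k (empty_mem_faces_of_nontrivial (k := k))] at hdim
    exact ⟨rs, by exact_mod_cast hdim.symm, hmem, hrs⟩
  · rintro ⟨rs, hlen, hmem, hrs⟩
    have := hrs.nontrivial
    refine ⟨rs, hmem, hrs, ?_⟩
    rw [ringKrullDim_srRing k (empty_mem_faces_of_nontrivial (k := k)), hlen]

end Dim
end SComplex

theorem monomial_mem_srIdeal {k : Type*} [CommRing k] {V : Type*} {Δ : SComplex V} {a : V →₀ ℕ}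
    (c : k) (ha : a.support ∉ Δ.faces) : monomial a c ∈ srIdeal k Δ := by
  classical
  refine mem_srIdeal_iff.mpr fun b hb => ?_
  rw [support_monomial] at hb
  split_ifs at hb with hc
  · simp at hb
  · rwa [mem_singleton.mp hb]

section SquareVar

variable {k : Type*} [Field k] {V : Type*} (v : V)

/-- The `squareVar v`-linear projection of the polynomial ring onto its submodule of polynomials
that are odd in the variable `v`. -/
noncomputable def oddPart : MvPolynomial V k →ₗ[k] MvPolynomial V k :=
  (basisMonomials V k).constr k fun a =>
    if Odd (a v) then monomial (a.update v (a v / 2)) 1 else 0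

theorem oddPart_monomial (a : V →₀ ℕ) (c : k) :
    oddPart v (monomial a c) = if Odd (a v) then monomial (a.update v (a v / 2)) c else 0 := by
  have : monomial a c = c • basisMonomials V k a := by simp [smul_monomial]
  rw [this, map_smul, oddPart, Module.Basis.constr_basis]
  split_ifs <;> simp [smul_monomial]

theorem oddPart_X : oddPart v (X v : MvPolynomial V k) = 1 := by
  rw [X, oddPart_monomial, if_pos (by simp)]
  have : (Finsupp.single v 1).update v ((Finsupp.single v 1 : V →₀ ℕ) v / 2) = 0 := by
    ext i
    classical
    by_cases hi : i = v
    · simp [hi]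
    · simp [Finsupp.update_apply, hi]
  rw [this, monomial_zero', C_1]

variable [DecidableEq V]

/-- The endomorphism of the polynomial ring which squares the variable `v`. -/
noncomputable def squareVar : MvPolynomial V k →ₐ[k] MvPolynomial V k :=
  aeval fun i => if i = v then X i ^ 2 else X i

theorem oddPart_squareVar_mul (p q : MvPolynomial V k) :
    oddPart v (squareVar v p * q) = p * oddPart v q := by
  induction p using MvPolynomial.induction_on generalizing q with
  | C a => simp [squareVar, C_mul']
  | add p₁ p₂ h₁ h₂ => rw [map_add, add_mul, map_add, h₁, h₂, add_mul]
  | mul_X p i hp =>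
    rw [map_mul (squareVar v), mul_assoc, hp, mul_assoc]
    congr 1
    induction q using MvPolynomial.induction_on' with
    | add q₁ q₂ h₁ h₂ => rw [mul_add, map_add, h₁, h₂, map_add, mul_add]
    | monomial a c =>
      by_cases hi : i = v
      · subst hi
        have h : squareVar i (X i) * monomial a c = monomial (Finsupp.single i 2 + a) c := by
          simp [squareVar, X_pow_eq_monomial, monomial_mul]
        rw [h, oddPart_monomial, oddPart_monomial]
        have h2 : Odd ((Finsupp.single i 2 + a : V →₀ ℕ) i) ↔ Odd (a i) := by
          rw [Finsupp.add_apply, Finsupp.single_eq_same, Nat.odd_add', iff_true_right even_two]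
        simp only [h2]
        split_ifs
        · rw [X, monomial_mul, one_mul]
          congr 2
          ext j
          by_cases hj : j = i
          · subst hj; simp; omega
          · simp [hj, Finsupp.update_apply]
        · simp
      · have h : squareVar v (X i) * monomial a c = monomial (Finsupp.single i 1 + a) c := by
          rw [squareVar, aeval_X, if_neg hi, X, monomial_mul, one_mul]
        rw [h, oddPart_monomial, oddPart_monomial]
        have h2 : (Finsupp.single i 1 + a : V →₀ ℕ) v = a v := by simp [hi]
        rw [h2]
        split_ifs
        · rw [X, monomial_mul, one_mul]
          congr 2
          ext j
          by_cases hj : j = v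
          · subst hj; simp [hi]
          · simp [hj, Finsupp.update_apply]
        · simp

theorem X_dvd_squareVar_X (i : V) : (X i : MvPolynomial V k) ∣ squareVar v (X i) := by
  rw [squareVar, aeval_X]
  split_ifs
  · exact dvd_pow_self _ two_ne_zero
  · exact dvd_rfl

theorem span_range_X_le_comap_squareVar :
    Ideal.span (Set.range (X : V → MvPolynomial V k)) ≤
      (Ideal.span (Set.range X)).comap (squareVar v).toRingHom := by
  rw [Ideal.span_le]
  rintro _ ⟨i, rfl⟩
  exact Ideal.mem_comap.mpr
    (Ideal.mem_of_dvd _ (X_dvd_squareVar_X v i) (Ideal.subset_span ⟨i, rfl⟩))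

theorem span_range_X_le_radical_map_squareVar :
    Ideal.span (Set.range (X : V → MvPolynomial V k)) ≤
      ((Ideal.span (Set.range X)).map (squareVar v).toRingHom).radical := by
  rw [Ideal.span_le]
  rintro _ ⟨i, rfl⟩
  have h : squareVar v (X i) ∈ (Ideal.span (Set.range X)).map
      (squareVar v : MvPolynomial V k →ₐ[k] MvPolynomial V k).toRingHom :=
    Ideal.mem_map_of_mem _ (Ideal.subset_span ⟨i, rfl⟩)
  rw [squareVar, aeval_X] at h
  split_ifs at h
  · exact ⟨2, h⟩
  · exact Ideal.le_radical h

end SquareVar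

namespace SComplex

variable {V : Type*} [DecidableEq V]

/-- The closed star of the vertex `v`: all sets `G` such that `G ∪ {v}` is a face. -/
def star (Δ : SComplex V) (v : V) : SComplex V where
  faces := {G | insert v G ∈ Δ.faces}
  down_closed _ _ hG hHG := Δ.down_closed hG (insert_subset_insert v hHG)

theorem mem_link {Δ : SComplex V} {F G : Finset V} :
    G ∈ (Δ.link F).faces ↔ Disjoint G F ∧ G ∪ F ∈ Δ.faces :=
  ⟨fun h => h.2, fun h => ⟨Δ.down_closed h.2 subset_union_left, h⟩⟩

variable {k : Type*} [Field k] {Δ : SComplex V} {v : V}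

theorem X_mul_squareVar_mem {p : MvPolynomial V k} (hp : p ∈ srIdeal k (Δ.star v)) :
    X v * squareVar v p ∈ srIdeal k Δ := by
  let J : Ideal (MvPolynomial V k) :=
    ((srIdeal k Δ).colon {X v}).comap (squareVar v).toRingHom
  have hJ : ∀ p, p ∈ J ↔ X v * squareVar v p ∈ srIdeal k Δ := fun p => by
    simp only [J, Ideal.mem_comap, Submodule.mem_colon_singleton, smul_eq_mul, mul_comm (X v)]
    rfl
  rw [← hJ]
  refine srIdeal_le_iff.mpr (fun G hG => ?_) hp
  rw [hJ]
  have h₁ : faceMonomial k G ∣ squareVar v (faceMonomial k G) := by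
    rw [faceMonomial, map_prod]
    exact prod_dvd_prod_of_dvd _ _ fun i _ => X_dvd_squareVar_X v i
  have h₂ : faceMonomial k (insert v G) ∣ X v * faceMonomial k G := by
    by_cases hv : v ∈ G
    · rw [insert_eq_of_mem hv]
      exact dvd_mul_left _ _
    · rw [faceMonomial, prod_insert hv]
      rfl
  exact Ideal.mem_of_dvd _ (h₂.trans (mul_dvd_mul_left _ h₁)) (faceMonomial_mem_srIdeal k hG)

theorem oddPart_mem {p : MvPolynomial V k} (hp : p ∈ srIdeal k Δ) :
    oddPart v p ∈ srIdeal k (Δ.star v) := by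
  rw [p.as_sum, map_sum]
  refine sum_mem fun a ha => ?_
  rw [oddPart_monomial]
  split_ifs with hodd
  · refine monomial_mem_srIdeal _ fun h => mem_srIdeal_iff.mp hp a ha (Δ.down_closed h ?_)
    intro i hi
    by_cases hiv : i = v
    · simp [hiv]
    · simpa [hiv, Finsupp.update_apply] using hi
  · exact zero_mem _

theorem DepthGE.star [Finite V] {n : ℕ} (h : Δ.DepthGE k n) (hv : {v} ∈ Δ.faces) :
    (Δ.star v).DepthGE k n := by
  obtain ⟨rs, rfl, hmem, hrs⟩ := exists_isWeaklyRegular_map (squareVar v).toRingHom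
    (span_range_X_le_comap_squareVar v) (span_range_X_le_radical_map_squareVar v)
    (smul_top_srRing_lt_top h.empty_mem) h
  refine DepthGE.of_isWeaklyRegular hv rs hmem ?_
  let f : MvPolynomial V k →ₛₗ[(squareVar v).toRingHom] MvPolynomial V k :=
    { toFun := fun p => X v * squareVar v p
      map_add' := fun p q => by rw [map_add, mul_add]
      map_smul' := fun p q => by
        rw [smul_eq_mul, map_mul, mul_left_comm]; rfl }
  let ι : srRing k (Δ.star v) →ₛₗ[(squareVar v).toRingHom] srRing k Δ :=
    Submodule.mapQ _ _ f fun p hp => X_mul_squareVar_mem hp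
  let π : srRing k Δ →+ srRing k (Δ.star v) :=
    QuotientAddGroup.map (srIdeal k Δ).toAddSubgroup (srIdeal k (Δ.star v)).toAddSubgroup
      (oddPart v).toAddMonoidHom fun p hp => oddPart_mem hp
  refine isWeaklyRegular_of_retract _ ι π (fun r m => ?_) (fun x => ?_) hrs
  · obtain ⟨q, rfl⟩ := Ideal.Quotient.mk_surjective m
    exact congrArg (Ideal.Quotient.mk _) (oddPart_squareVar_mul v r q)
  · obtain ⟨q, rfl⟩ := Ideal.Quotient.mk_surjective x
    refine congrArg (Ideal.Quotient.mk _) (?_ : oddPart v (X v * squareVar v q) = q)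
    rw [mul_comm, oddPart_squareVar_mul, oddPart_X, mul_one]

theorem isSMulRegular_X_star : IsSMulRegular (srRing k (Δ.star v)) (X v : MvPolynomial V k) := by
  rw [isSMulRegular_iff_right_eq_zero_of_smul]
  intro x hx
  obtain ⟨p, rfl⟩ := Ideal.Quotient.mk_surjective x
  have hx' : X v * p ∈ srIdeal k (Δ.star v) := Ideal.Quotient.eq_zero_iff_mem.mp hx
  refine Ideal.Quotient.eq_zero_iff_mem.mpr (mem_srIdeal_iff.mpr fun a ha hmem => ?_)
  refine mem_srIdeal_iff.mp hx' (Finsupp.single v 1 + a) ?_ (Δ.down_closed hmem ?_)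
  · rw [mem_support_iff, coeff_X_mul]
    exact mem_support_iff.mp ha
  · intro i hi
    by_cases hiv : i = v
    · simp [hiv]
    · simpa [hiv, Finsupp.single_apply, Ne.symm hiv] using hi

theorem srIdeal_link_singleton :
    srIdeal k (Δ.link {v}) = srIdeal k (Δ.star v) ⊔ Ideal.span {X v} := by
  apply le_antisymm
  · refine srIdeal_le_iff.mpr fun G hG => ?_
    by_cases hv : v ∈ G
    · refine Ideal.mem_sup_right (Ideal.mem_span_singleton.mpr ?_)
      exact dvd_prod_of_mem _ hv
    · refine Ideal.mem_sup_left (faceMonomial_mem_srIdeal k fun h => hG ?_)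
      rw [mem_link, disjoint_singleton_right, union_comm, ← insert_eq]
      exact ⟨hv, h⟩
  · refine sup_le (srIdeal_le_iff.mpr fun G hG => faceMonomial_mem_srIdeal k fun h => hG ?_) ?_
    · rw [mem_link, union_comm, ← insert_eq] at h
      exact h.2
    · rw [Ideal.span_le, Set.singleton_subset_iff]
      have : faceMonomial k {v} ∈ srIdeal k (Δ.link {v}) :=
        faceMonomial_mem_srIdeal k fun h => by simp [mem_link] at h
      simpa [faceMonomial] using this

/-- The Stanley–Reisner ring of the link of `v` is the quotient of that of the star by `X v`. -/
noncomputable def quotSMulTopStarEquiv (Δ : SComplex V) (v : V) :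
    QuotSMulTop (X v : MvPolynomial V k) (srRing k (Δ.star v)) ≃ₗ[MvPolynomial V k]
      srRing k (Δ.link {v}) :=
  let f : srRing k (Δ.star v) →ₗ[MvPolynomial V k] srRing k (Δ.link {v}) :=
    Submodule.mapQ _ _ LinearMap.id
      (le_sup_left.trans (srIdeal_link_singleton (k := k) (Δ := Δ) (v := v)).ge)
  Submodule.quotEquivOfEq _ (LinearMap.ker f) (by
    ext x
    obtain ⟨p, rfl⟩ := Ideal.Quotient.mk_surjective x
    have h : Ideal.Quotient.mk _ p ∈ LinearMap.ker f ↔ p ∈ srIdeal k (Δ.link {v}) :=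
      Ideal.Quotient.eq_zero_iff_mem
    rw [h, srIdeal_link_singleton, Submodule.mem_smul_pointwise_iff_exists]
    constructor
    · rintro ⟨y, -, hy⟩
      obtain ⟨q, rfl⟩ := Ideal.Quotient.mk_surjective y
      have hy' : X v * q - p ∈ srIdeal k (Δ.star v) := Ideal.Quotient.eq.mp hy
      rw [← sub_sub_cancel (X v * q) p]
      exact sub_mem (Ideal.mem_sup_right (Ideal.mem_span_singleton.mpr (dvd_mul_right _ _)))
        (Ideal.mem_sup_left hy')
    · intro hp
      obtain ⟨a, ha, b, hb, rfl⟩ := Submodule.mem_sup.mp hp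
      obtain ⟨q, rfl⟩ := Ideal.mem_span_singleton.mp hb
      refine ⟨Ideal.Quotient.mk _ q, trivial, ?_⟩
      refine Ideal.Quotient.eq.mpr (?_ : X v * q - (a + X v * q) ∈ _)
      simpa using ha) ≪≫ₗ
  f.quotKerEquivOfSurjective fun y => by
    obtain ⟨p, rfl⟩ := Ideal.Quotient.mk_surjective y
    exact ⟨Ideal.Quotient.mk _ p, rfl⟩

theorem DepthGE.link_singleton [Finite V] {n : ℕ} (h : Δ.DepthGE k (n + 1)) (hv : {v} ∈ Δ.faces) :
    (Δ.link {v}).DepthGE k n := by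
  obtain ⟨-, rs, hlen, hmem, hrs⟩ := exists_isRegular_quotSMulTop (y := (X v : MvPolynomial V k))
    (smul_top_srRing_lt_top (k := k) (Δ := Δ.star v) hv) (h.star hv)
    (Ideal.subset_span ⟨v, rfl⟩) isSMulRegular_X_star
  exact ⟨rs, hlen, hmem, ((quotSMulTopStarEquiv Δ v).isRegular_congr rs).mp hrs⟩

theorem link_insert {F : Finset V} (hv : v ∉ F) : (Δ.link F).link {v} = Δ.link (insert v F) := by
  refine eq_of_mem_iff fun G => ?_
  simp only [mem_link, disjoint_singleton_right, disjoint_union_left, disjoint_insert_right,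
    union_assoc, ← insert_eq, disjoint_singleton_left]
  tauto

theorem DepthGE.link [Finite V] {n : ℕ} (h : Δ.DepthGE k n) {F : Finset V} (hF : F ∈ Δ.faces) :
    (Δ.link F).DepthGE k (n - F.card) := by
  induction F using Finset.induction_on with
  | empty =>
    have : Δ.link ∅ = Δ := eq_of_mem_iff fun G => by simp [mem_link]
    simpa [this] using h
  | insert v F hv ih =>
    have ih := ih (Δ.down_closed hF (subset_insert v F))
    have hmem : {v} ∈ (Δ.link F).faces := by simpa [mem_link, hv, ← insert_eq] using hF
    rw [← link_insert hv, card_insert_of_notMem hv]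
    rcases Nat.eq_zero_or_pos (n - F.card) with h0 | h0
    · rw [← Nat.sub_sub, h0]
      refine DepthGE.of_isWeaklyRegular (rs := []) ?_ (by simp) (by simp)
      simpa [mem_link, hv, ← insert_eq] using hF
    · refine DepthGE.link_singleton ?_ hmem
      rwa [← Nat.sub_sub, Nat.sub_add_cancel h0]

end SComplex

theorem isWeaklyRegular_append_of_surjective {T T' : Type*} [CommRing T] [CommRing T']
    (f : T →+* T') (hf : Function.Surjective f) {rs rs' : List T}
    (hker : RingHom.ker f = Ideal.ofList rs) (h : IsWeaklyRegular T rs)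
    (h' : IsWeaklyRegular T' (rs'.map f)) : IsWeaklyRegular T (rs ++ rs') := by
  let := f.toAlgebra
  rw [isWeaklyRegular_append_iff]
  refine ⟨h, ?_⟩
  have hk : LinearMap.ker (Algebra.linearMap T T') = Ideal.ofList rs • (⊤ : Submodule T T) := by
    rw [smul_eq_mul, Ideal.mul_top, ← hker]
    rfl
  rw [← (Submodule.quotEquivOfEq _ _ hk).isWeaklyRegular_congr,
    ((Algebra.linearMap T T').quotKerEquivOfSurjective hf).isWeaklyRegular_congr]
  exact (isWeaklyRegular_map_algebraMap_iff T' T' rs').mp h'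

theorem isWeaklyRegular_tensorProduct {k A B : Type*} [Field k] [CommRing A] [CommRing B]
    [Algebra k A] [Algebra k B] {rs : List A} {rs' : List B} (h : IsWeaklyRegular A rs)
    (h' : IsWeaklyRegular B rs') :
    IsWeaklyRegular (A ⊗[k] B) (rs.map (fun a => a ⊗ₜ[k] 1) ++ rs'.map (fun b => 1 ⊗ₜ[k] b)) := by
  let q : A →ₐ[k] A ⧸ Ideal.ofList rs := Ideal.Quotient.mkₐ k _
  have hq : Function.Surjective q := Ideal.Quotient.mkₐ_surjective k _
  let f : A ⊗[k] B →ₐ[k] B ⊗[k] (A ⧸ Ideal.ofList rs) :=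
    (Algebra.TensorProduct.comm k _ _).toAlgHom.comp
      (Algebra.TensorProduct.map q (AlgHom.id k B))
  refine isWeaklyRegular_append_of_surjective f.toRingHom ?_ ?_ ?_ ?_
  · exact (Algebra.TensorProduct.comm k _ _).surjective.comp
      (TensorProduct.map_surjective hq Function.surjective_id)
  · have : RingHom.ker f.toRingHom =
        RingHom.ker (Algebra.TensorProduct.map q (AlgHom.id k B)) := by
      ext x
      exact EmbeddingLike.map_eq_zero_iff (f := Algebra.TensorProduct.comm k _ _)
    rw [this, Algebra.TensorProduct.rTensor_ker _ hq]
    have hkq : RingHom.ker q = Ideal.ofList rs := Ideal.Quotient.mkₐ_ker k _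
    rw [hkq]
    exact Ideal.map_ofList
      (Algebra.TensorProduct.includeLeft (R := k) (A := A) (B := B)).toRingHom rs
  · exact h.of_flat
  · have := h'.of_flat (S := B ⊗[k] (A ⧸ Ideal.ofList rs))
    rw [List.map_map]
    convert this using 2
    ext b
    simp [f]

theorem isWeaklyRegular_append_of_tensorProduct {k A B C : Type*} [Field k] [CommRing A]
    [CommRing B] [CommRing C] [Algebra k A] [Algebra k B] [Algebra k C] (j₁ : A →ₐ[k] C) (j₂ : B →ₐ[k] C)
    (g : C →ₐ[k] A ⊗[k] B) (hg : (Algebra.TensorProduct.productMap j₁ j₂).comp g = AlgHom.id k C)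
    (h₁ : g.comp j₁ = Algebra.TensorProduct.includeLeft)
    (h₂ : g.comp j₂ = Algebra.TensorProduct.includeRight) {rs : List A} {rs' : List B}
    (h : IsWeaklyRegular A rs) (h' : IsWeaklyRegular B rs') :
    IsWeaklyRegular C (rs.map j₁ ++ rs'.map j₂) := by
  have hreg := isWeaklyRegular_tensorProduct (k := k) h h'
  have hmap : rs.map (fun a => a ⊗ₜ[k] (1 : B)) ++ rs'.map (fun b => (1 : A) ⊗ₜ[k] b) =
      (rs.map j₁ ++ rs'.map j₂).map g.toRingHom := by
    rw [List.map_append, List.map_map, List.map_map]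
    congr 2
    · exact funext fun a => (DFunLike.congr_fun h₁ a).symm
    · exact funext fun b => (DFunLike.congr_fun h₂ b).symm
  rw [hmap] at hreg
  let ι : C →ₛₗ[g.toRingHom] A ⊗[k] B :=
    { toFun := g
      map_add' := map_add g
      map_smul' := map_mul g }
  let π : A ⊗[k] B →ₐ[k] C := Algebra.TensorProduct.productMap j₁ j₂
  refine isWeaklyRegular_of_retract g.toRingHom ι π.toRingHom.toAddMonoidHom (fun r m => ?_)
    (fun x => DFunLike.congr_fun hg x) hreg
  exact (map_mul π (g r) m).trans (congrArg (· * π m) (DFunLike.congr_fun hg r))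

theorem map_faceMonomial_tensorProduct {k A B V : Type*} [Field k] [CommRing A] [CommRing B]
    [Algebra k A] [Algebra k B] [DecidableEq V] (p : MvPolynomial V k →ₐ[k] A)
    (q : MvPolynomial V k →ₐ[k] B) (H : Finset V) :
    aeval (fun i => p (X i) ⊗ₜ[k] 1 + 1 ⊗ₜ[k] q (X i)) (faceMonomial k H) =
      ∑ F ∈ H.powerset, p (faceMonomial k F) ⊗ₜ[k] q (faceMonomial k (H \ F)) := by
  have h₁ (F : Finset V) : p (faceMonomial k F) ⊗ₜ[k] (1 : B) =
      ∏ i ∈ F, p (X i) ⊗ₜ[k] (1 : B) := by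
    rw [faceMonomial, map_prod]
    exact map_prod (Algebra.TensorProduct.includeLeft : A →ₐ[k] A ⊗[k] B) _ F
  have h₂ (F : Finset V) : (1 : A) ⊗ₜ[k] q (faceMonomial k F) =
      ∏ i ∈ F, (1 : A) ⊗ₜ[k] q (X i) := by
    rw [faceMonomial, map_prod]
    exact map_prod (Algebra.TensorProduct.includeRight : B →ₐ[k] A ⊗[k] B) _ F
  rw [faceMonomial, map_prod]
  simp only [aeval_X]
  refine (prod_add _ _ H).trans (sum_congr rfl fun F _ => ?_)
  rw [← mul_one (p (faceMonomial k F)), ← one_mul (q (faceMonomial k (H \ F))),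
    ← Algebra.TensorProduct.tmul_mul_tmul, h₁, h₂]

namespace SComplex

section Join

variable {k : Type*} [Field k] {V : Type*}

open Classical in
/-- The map of Stanley–Reisner rings sending each vertex of `Δ` to itself and every other
variable to zero. -/
noncomputable def vertexMap (Δ Δ' : SComplex V)
    (h : ∀ F ∈ Δ'.faces, (∀ i ∈ F, {i} ∈ Δ.faces) → F ∈ Δ.faces) :
    srRing k Δ →ₐ[k] srRing k Δ' :=
  Ideal.Quotient.liftₐ _
    (aeval fun i => if {i} ∈ Δ.faces then Ideal.Quotient.mk (srIdeal k Δ') (X i) else 0) <| by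
    intro p hp
    refine (srIdeal_le_iff (I := RingHom.ker (aeval fun i => if {i} ∈ Δ.faces then
      Ideal.Quotient.mk (srIdeal k Δ') (X i) else 0))).mpr (fun F hF => ?_) hp
    rw [RingHom.mem_ker, faceMonomial, map_prod]
    simp only [aeval_X]
    by_cases hi : ∃ i ∈ F, {i} ∉ Δ.faces
    · obtain ⟨i, hiF, hi⟩ := hi
      exact prod_eq_zero hiF (if_neg hi)
    · push Not at hi
      rw [prod_congr rfl fun i hiF => if_pos (hi i hiF), ← map_prod]
      exact Ideal.Quotient.eq_zero_iff_mem.mpr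
        (faceMonomial_mem_srIdeal k fun hF' => hF (h F hF' hi))

open Classical in
theorem vertexMap_mk_X (Δ Δ' : SComplex V)
    (h : ∀ F ∈ Δ'.faces, (∀ i ∈ F, {i} ∈ Δ.faces) → F ∈ Δ.faces) (i : V) :
    vertexMap Δ Δ' h (Ideal.Quotient.mk (srIdeal k Δ) (X i)) =
      if {i} ∈ Δ.faces then Ideal.Quotient.mk (srIdeal k Δ') (X i) else 0 :=
  aeval_X _ i

theorem vertexMap_mem_srIrrelevant {Δ Δ' : SComplex V}
    (h : ∀ F ∈ Δ'.faces, (∀ i ∈ F, {i} ∈ Δ.faces) → F ∈ Δ.faces) {x : srRing k Δ}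
    (hx : x ∈ srIrrelevant k Δ) : vertexMap Δ Δ' h x ∈ srIrrelevant k Δ' := by
  have hle : srIrrelevant k Δ ≤ (srIrrelevant k Δ').comap (vertexMap Δ Δ' h) := by
    rw [srIrrelevant, Ideal.map_le_iff_le_comap, Ideal.span_le]
    rintro _ ⟨i, rfl⟩
    simp only [SetLike.mem_coe, Ideal.mem_comap, vertexMap_mk_X]
    split_ifs
    · exact Ideal.mem_map_of_mem _ (Ideal.subset_span ⟨i, rfl⟩)
    · exact zero_mem _
  exact hle hx

theorem mk_X_eq_zero {Δ : SComplex V} {i : V} (hi : {i} ∉ Δ.faces) :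
    Ideal.Quotient.mk (srIdeal k Δ) (X i) = 0 :=
  Ideal.Quotient.eq_zero_iff_mem.mpr (by
    simpa [faceMonomial] using faceMonomial_mem_srIdeal k hi)

theorem singleton_mem_of_mem {Δ : SComplex V} {F : Finset V} (hF : F ∈ Δ.faces) {i : V}
    (hi : i ∈ F) : {i} ∈ Δ.faces :=
  Δ.down_closed hF (singleton_subset_iff.mpr hi)

variable {Δ₁ Δ₂ : SComplex V}

theorem disjoint_faces (hdisj : Disjoint Δ₁.vertexSet Δ₂.vertexSet) {F G : Finset V}
    (hF : F ∈ Δ₁.faces) (hG : G ∈ Δ₂.faces) : Disjoint F G :=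
  Finset.disjoint_left.mpr fun _ hi hi' => Set.disjoint_left.mp hdisj
    (singleton_mem_of_mem hF hi) (singleton_mem_of_mem hG hi')

variable [DecidableEq V]

theorem mem_join {H : Finset V} :
    H ∈ (Δ₁.join Δ₂).faces ↔ ∃ F ∈ Δ₁.faces, ∃ G ∈ Δ₂.faces, H = F ∪ G := Iff.rfl

theorem join_comm (Δ₁ Δ₂ : SComplex V) : Δ₁.join Δ₂ = Δ₂.join Δ₁ :=
  eq_of_mem_iff fun H => by
    simp only [mem_join]
    constructor <;> rintro ⟨F, hF, G, hG, rfl⟩ <;> exact ⟨G, hG, F, hF, union_comm _ _⟩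

theorem mem_left_of_mem_join (hdisj : Disjoint Δ₁.vertexSet Δ₂.vertexSet) {H : Finset V}
    (hH : H ∈ (Δ₁.join Δ₂).faces) (h : ∀ i ∈ H, {i} ∈ Δ₁.faces) : H ∈ Δ₁.faces := by
  obtain ⟨F, hF, G, hG, rfl⟩ := hH
  have : G = ∅ := eq_empty_of_forall_notMem fun i hi =>
    Set.disjoint_left.mp hdisj (h i (mem_union_right F hi)) (singleton_mem_of_mem hG hi)
  rwa [this, union_empty]

theorem mem_right_of_mem_join (hdisj : Disjoint Δ₁.vertexSet Δ₂.vertexSet) {H : Finset V}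
    (hH : H ∈ (Δ₁.join Δ₂).faces) (h : ∀ i ∈ H, {i} ∈ Δ₂.faces) : H ∈ Δ₂.faces :=
  mem_left_of_mem_join hdisj.symm (join_comm Δ₁ Δ₂ ▸ hH) h

/-- The map from the Stanley–Reisner ring of a join to the tensor product of the Stanley–Reisner
rings, sending each variable `x` to `x ⊗ 1 + 1 ⊗ x`. -/
noncomputable def joinToTensor (k : Type*) [Field k] (Δ₁ Δ₂ : SComplex V) :
    srRing k (Δ₁.join Δ₂) →ₐ[k] srRing k Δ₁ ⊗[k] srRing k Δ₂ :=
  Ideal.Quotient.liftₐ _ (aeval fun i => Ideal.Quotient.mkₐ k (srIdeal k Δ₁) (X i) ⊗ₜ[k] 1 +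
    1 ⊗ₜ[k] Ideal.Quotient.mkₐ k (srIdeal k Δ₂) (X i)) <| by
    intro p hp
    refine (srIdeal_le_iff (I := RingHom.ker (aeval fun i =>
      Ideal.Quotient.mkₐ k (srIdeal k Δ₁) (X i) ⊗ₜ[k] 1 +
        1 ⊗ₜ[k] Ideal.Quotient.mkₐ k (srIdeal k Δ₂) (X i)))).mpr (fun H hH => ?_) hp
    refine (map_faceMonomial_tensorProduct _ _ H).trans ?_
    refine sum_eq_zero fun F hF => ?_
    by_cases hF₁ : F ∈ Δ₁.faces
    · have hF₂ : H \ F ∉ Δ₂.faces := fun hF₂ =>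
        hH ⟨F, hF₁, _, hF₂, (union_sdiff_of_subset (mem_powerset.mp hF)).symm⟩
      rw [Ideal.Quotient.mkₐ_eq_mk, Ideal.Quotient.mkₐ_eq_mk,
        Ideal.Quotient.eq_zero_iff_mem.mpr (faceMonomial_mem_srIdeal k hF₂),
        TensorProduct.tmul_zero]
    · rw [Ideal.Quotient.mkₐ_eq_mk, Ideal.Quotient.mkₐ_eq_mk,
        Ideal.Quotient.eq_zero_iff_mem.mpr (faceMonomial_mem_srIdeal k hF₁),
        TensorProduct.zero_tmul]

theorem joinToTensor_mk_X (i : V) :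
    joinToTensor k Δ₁ Δ₂ (Ideal.Quotient.mk _ (X i)) =
      Ideal.Quotient.mk _ (X i) ⊗ₜ 1 + 1 ⊗ₜ Ideal.Quotient.mk _ (X i) :=
  aeval_X _ i

theorem DepthGE.join {n m : ℕ} (h₁ : Δ₁.DepthGE k n) (h₂ : Δ₂.DepthGE k m)
    (hdisj : Disjoint Δ₁.vertexSet Δ₂.vertexSet) : (Δ₁.join Δ₂).DepthGE k (n + m) := by
  have hempty : ∅ ∈ (Δ₁.join Δ₂).faces :=
    ⟨∅, h₁.empty_mem, ∅, h₂.empty_mem, (union_empty _).symm⟩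
  obtain ⟨rs₁, rfl, hmem₁, hrs₁⟩ := depthGE_iff.mp h₁
  obtain ⟨rs₂, rfl, hmem₂, hrs₂⟩ := depthGE_iff.mp h₂
  let j₁ : srRing k Δ₁ →ₐ[k] srRing k (Δ₁.join Δ₂) :=
    vertexMap _ _ fun _ => mem_left_of_mem_join hdisj
  let j₂ : srRing k Δ₂ →ₐ[k] srRing k (Δ₁.join Δ₂) :=
    vertexMap _ _ fun _ => mem_right_of_mem_join hdisj
  let g := joinToTensor k Δ₁ Δ₂
  have hgj₁ : g.comp j₁ = Algebra.TensorProduct.includeLeft := by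
    refine Ideal.Quotient.algHom_ext _ (MvPolynomial.algHom_ext fun i => ?_)
    suffices g (j₁ (Ideal.Quotient.mk _ (X i))) = Ideal.Quotient.mk _ (X i) ⊗ₜ 1 from this
    simp only [j₁, g, vertexMap_mk_X]
    split_ifs with hi
    · rw [joinToTensor_mk_X, mk_X_eq_zero (Set.disjoint_left.mp hdisj hi), TensorProduct.tmul_zero,
        add_zero]
    · rw [mk_X_eq_zero hi, map_zero, TensorProduct.zero_tmul]
  have hgj₂ : g.comp j₂ = Algebra.TensorProduct.includeRight := by
    refine Ideal.Quotient.algHom_ext _ (MvPolynomial.algHom_ext fun i => ?_)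
    suffices g (j₂ (Ideal.Quotient.mk _ (X i))) = 1 ⊗ₜ Ideal.Quotient.mk _ (X i) from this
    simp only [j₂, g, vertexMap_mk_X]
    split_ifs with hi
    · rw [joinToTensor_mk_X, mk_X_eq_zero (Set.disjoint_right.mp hdisj hi),
        TensorProduct.zero_tmul, zero_add]
    · rw [mk_X_eq_zero hi, map_zero, TensorProduct.tmul_zero]
  have hg : (Algebra.TensorProduct.productMap j₁ j₂).comp g = AlgHom.id k _ := by
    refine Ideal.Quotient.algHom_ext _ (MvPolynomial.algHom_ext fun i => ?_)
    suffices Algebra.TensorProduct.productMap j₁ j₂ (g (Ideal.Quotient.mk _ (X i))) =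
      Ideal.Quotient.mk _ (X i) from this
    simp only [g, joinToTensor_mk_X, map_add, Algebra.TensorProduct.productMap_apply_tmul,
      map_one, mul_one, one_mul, j₁, j₂, vertexMap_mk_X]
    split_ifs with hi₁ hi₂ hi₂
    · exact absurd hi₂ (Set.disjoint_left.mp hdisj hi₁)
    · exact add_zero _
    · exact zero_add _
    · rw [add_zero, mk_X_eq_zero]
      rintro ⟨F, hF, G, hG, hFG⟩
      have : i ∈ F ∪ G := hFG ▸ mem_singleton_self i
      rcases mem_union.mp this with hi | hi
      exacts [hi₁ (singleton_mem_of_mem hF hi), hi₂ (singleton_mem_of_mem hG hi)]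
  have hmem : ∀ r ∈ rs₁.map j₁ ++ rs₂.map j₂, r ∈ srIrrelevant k (Δ₁.join Δ₂) := by
    simp only [List.mem_append, List.mem_map]
    rintro _ (⟨r, hr, rfl⟩ | ⟨r, hr, rfl⟩)
    · exact vertexMap_mem_srIrrelevant _ (hmem₁ r hr)
    · exact vertexMap_mem_srIrrelevant _ (hmem₂ r hr)
  simpa using DepthGE.of_isWeaklyRegular_srRing hempty _ hmem
    (isWeaklyRegular_append_of_tensorProduct j₁ j₂ g hg hgj₁ hgj₂ hrs₁.1 hrs₂.1)

end Join
end SComplex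

namespace SComplex

section Link

variable {k : Type*} [Field k] {V : Type*} {Δ : SComplex V}

theorem DepthGE.eq_zero_of_forall_singleton_notMem {n : ℕ} (h : Δ.DepthGE k n)
    (hΔ : ∀ i, {i} ∉ Δ.faces) : n = 0 := by
  obtain ⟨rs, rfl, hmem, hrs⟩ := h
  rcases rs with _ | ⟨r, rs⟩
  · rfl
  have := hrs.nontrivial
  have hle : Ideal.span (Set.range (X : V → MvPolynomial V k)) ≤ srIdeal k Δ := by
    rw [Ideal.span_le]
    rintro _ ⟨i, rfl⟩
    exact Ideal.Quotient.eq_zero_iff_mem.mp (mk_X_eq_zero (hΔ i))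
  have hr : r • (1 : srRing k Δ) = 0 :=
    Ideal.Quotient.eq_zero_iff_mem.mpr (Ideal.mul_mem_right 1 _ (hle (hmem r (by simp))))
  have hreg := ((isRegular_cons_iff _ r rs).mp hrs).1
  exact absurd (hreg (hr.trans (smul_zero r).symm)) one_ne_zero

variable [DecidableEq V]

variable [Fintype V]

theorem IsCM.card_eq_of_isFacet (h : Δ.IsCM k) {F : Finset V} (hF : Δ.IsFacet F) :
    F.card = Δ.dimSucc := by
  refine le_antisymm (card_le_dimSucc hF.1) (Nat.sub_eq_zero_iff_le.mp ?_)
  refine ((isCM_iff.mp h).link hF.1).eq_zero_of_forall_singleton_notMem fun i hi => ?_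
  rw [mem_link, disjoint_singleton_left] at hi
  have := hF.2 _ hi.2 subset_union_right
  exact hi.1 (this ▸ mem_union_left _ (mem_singleton_self i))

theorem IsCM.dimSucc_link (h : Δ.IsCM k) {F : Finset V} (hF : F ∈ Δ.faces) :
    (Δ.link F).dimSucc = Δ.dimSucc - F.card := by
  refine dimSucc_eq (fun G hG => ?_) ?_
  · rw [mem_link] at hG
    have := card_le_dimSucc hG.2
    rw [card_union_of_disjoint hG.1] at this
    omega
  · obtain ⟨H, hH, hFH⟩ := exists_isFacet_superset hF
    refine ⟨H \ F, ?_, ?_⟩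
    · rw [mem_link, sdiff_union_of_subset hFH]
      exact ⟨sdiff_disjoint, hH.1⟩
    · rw [card_sdiff_of_subset hFH, h.card_eq_of_isFacet hH]

/-- Links of faces in a Cohen–Macaulay complex are Cohen–Macaulay. -/
theorem IsCM.link (h : Δ.IsCM k) {F : Finset V} (hF : F ∈ Δ.faces) : (Δ.link F).IsCM k := by
  rw [isCM_iff, h.dimSucc_link hF]
  exact (isCM_iff.mp h).link hF

end Link

section Join

variable {k : Type*} [Field k] {V : Type*} [DecidableEq V] {Δ₁ Δ₂ : SComplex V}

theorem dimSucc_join [Fintype V] (hdisj : Disjoint Δ₁.vertexSet Δ₂.vertexSet)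
    (h₁ : ∅ ∈ Δ₁.faces) (h₂ : ∅ ∈ Δ₂.faces) :
    (Δ₁.join Δ₂).dimSucc = Δ₁.dimSucc + Δ₂.dimSucc := by
  refine dimSucc_eq ?_ ?_
  · rintro _ ⟨F, hF, G, hG, rfl⟩
    exact (card_union_le F G).trans (add_le_add (card_le_dimSucc hF) (card_le_dimSucc hG))
  · obtain ⟨F, hF, hFc⟩ := exists_card_eq_dimSucc h₁
    obtain ⟨G, hG, hGc⟩ := exists_card_eq_dimSucc h₂
    exact ⟨F ∪ G, ⟨F, hF, G, hG, rfl⟩, by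
      rw [card_union_of_disjoint (disjoint_faces hdisj hF hG), hFc, hGc]⟩

/-- The join of two Cohen–Macaulay complexes on disjoint vertex sets is Cohen–Macaulay. -/
theorem IsCM.join [Fintype V] (h₁ : Δ₁.IsCM k) (h₂ : Δ₂.IsCM k)
    (hdisj : Disjoint Δ₁.vertexSet Δ₂.vertexSet) : (Δ₁.join Δ₂).IsCM k := by
  rw [isCM_iff] at h₁ h₂ ⊢
  rw [dimSucc_join hdisj h₁.empty_mem h₂.empty_mem]
  exact h₁.join h₂ hdisj

theorem union_subset_union_iff (hdisj : Disjoint Δ₁.vertexSet Δ₂.vertexSet)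
    {F F' G G' : Finset V} (hF : F ∈ Δ₁.faces) (hF' : F' ∈ Δ₁.faces) (hG : G ∈ Δ₂.faces)
    (hG' : G' ∈ Δ₂.faces) : F ∪ G ⊆ F' ∪ G' ↔ F ⊆ F' ∧ G ⊆ G' := by
  refine ⟨fun h => ⟨?_, ?_⟩, fun h => union_subset_union h.1 h.2⟩
  · exact (disjoint_faces hdisj hF hG').left_le_of_le_sup_right (subset_union_left.trans h)
  · exact (disjoint_faces hdisj hF' hG).symm.left_le_of_le_sup_left (subset_union_right.trans h)

theorem isFacet_join_iff (hdisj : Disjoint Δ₁.vertexSet Δ₂.vertexSet) {H : Finset V} :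
    (Δ₁.join Δ₂).IsFacet H ↔ ∃ F G, Δ₁.IsFacet F ∧ Δ₂.IsFacet G ∧ H = F ∪ G := by
  constructor
  · rintro ⟨⟨F, hF, G, hG, rfl⟩, hmax⟩
    refine ⟨F, G, ⟨hF, fun F' hF' hsub => ?_⟩, ⟨hG, fun G' hG' hsub => ?_⟩, rfl⟩
    · have := hmax (F' ∪ G) ⟨F', hF', G, hG, rfl⟩ (union_subset_union hsub subset_rfl)
      exact hsub.antisymm ((union_subset_union_iff hdisj hF' hF hG hG).mp this.ge).1
    · have := hmax (F ∪ G') ⟨F, hF, G', hG', rfl⟩ (union_subset_union subset_rfl hsub)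
      exact hsub.antisymm ((union_subset_union_iff hdisj hF hF hG' hG).mp this.ge).2
  · rintro ⟨F, G, hF, hG, rfl⟩
    refine ⟨⟨F, hF.1, G, hG.1, rfl⟩, ?_⟩
    rintro _ ⟨F', hF', G', hG', rfl⟩ hsub
    rw [union_subset_union_iff hdisj hF.1 hF' hG.1 hG'] at hsub
    rw [hF.2 F' hF' hsub.1, hG.2 G' hG' hsub.2]

theorem link_join (hdisj : Disjoint Δ₁.vertexSet Δ₂.vertexSet) {F G : Finset V}
    (hF : F ∈ Δ₁.faces) (hG : G ∈ Δ₂.faces) :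
    (Δ₁.join Δ₂).link (F ∪ G) = (Δ₁.link F).join (Δ₂.link G) := by
  refine eq_of_mem_iff fun H => ?_
  rw [mem_link, mem_join]
  constructor
  · rintro ⟨hd, F', hF', G', hG', hH⟩
    obtain ⟨hFF', hGG'⟩ := (union_subset_union_iff hdisj hF hF' hG hG').mp
      (hH ▸ subset_union_right)
    refine ⟨F' \ F, ?_, G' \ G, ?_, ?_⟩
    · rw [mem_link, sdiff_union_of_subset hFF']
      exact ⟨sdiff_disjoint, hF'⟩
    · rw [mem_link, sdiff_union_of_subset hGG']
      exact ⟨sdiff_disjoint, hG'⟩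
    · have h₁ := disjoint_faces hdisj hF hG'
      have h₂ := disjoint_faces hdisj hF' hG
      have : H = (F' ∪ G') \ (F ∪ G) := by rw [← hH, union_sdiff_cancel_right hd]
      rw [this]
      ext x
      have h₁ : x ∈ F → x ∉ G' := fun hx => Finset.disjoint_left.mp h₁ hx
      have h₂ : x ∈ F' → x ∉ G := fun hx => Finset.disjoint_left.mp h₂ hx
      simp only [mem_sdiff, mem_union]
      tauto
  · rintro ⟨F', hF', G', hG', rfl⟩
    have h₁ := disjoint_faces hdisj hF hG'.1
    have h₂ := disjoint_faces hdisj hF'.1 hG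
    rw [mem_link] at hF' hG'
    refine ⟨?_, F' ∪ F, hF'.2, G' ∪ G, hG'.2, union_union_union_comm _ _ _ _⟩
    simp only [disjoint_union_left, disjoint_union_right]
    exact ⟨⟨hF'.1, h₁.symm⟩, ⟨h₂, hG'.1⟩⟩

theorem disjoint_vertexSet_link (hdisj : Disjoint Δ₁.vertexSet Δ₂.vertexSet) (F G : Finset V) :
    Disjoint (Δ₁.link F).vertexSet (Δ₂.link G).vertexSet :=
  hdisj.mono (fun _ h => h.1) fun _ h => h.1

end Join

end SComplex

/-- If `Δ₁` is Cohen–Macaulay of dimension `r₁ - 1` and `Δ₂` is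
`CM_t` with `t ≥ 1` (on disjoint vertex sets), then `Δ₁ ∗ Δ₂` is `CM_{r₁+t}`;
moreover, if `Δ₂` is strictly `CM_t` then `Δ₁ ∗ Δ₂` is strictly `CM_{r₁+t}`. -/
theorem join_isCMt {V : Type*} [DecidableEq V] [Fintype V] (k : Type*) [Field k]
    (Δ₁ Δ₂ : SComplex V) (r₁ t : ℕ) (ht : 1 ≤ t)
    (hdisj : Disjoint Δ₁.vertexSet Δ₂.vertexSet)
    (hdim : Δ₁.dimSucc = r₁) (hCM : Δ₁.IsCM k) (hCMt : SComplex.IsCMt k t Δ₂) :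
    SComplex.IsCMt k (r₁ + t) (Δ₁.join Δ₂) ∧
      (¬ SComplex.IsCMt k (t - 1) Δ₂ → ¬ SComplex.IsCMt k (r₁ + t - 1) (Δ₁.join Δ₂)) := by
  subst hdim
  refine ⟨⟨fun H H' hH hH' => ?_, ?_⟩, mt fun h => ⟨hCMt.1, fun G hG hGt => ?_⟩⟩
  · obtain ⟨F, G, hF, hG, rfl⟩ := (SComplex.isFacet_join_iff hdisj).mp hH
    obtain ⟨F', G', hF', hG', rfl⟩ := (SComplex.isFacet_join_iff hdisj).mp hH'
    rw [card_union_of_disjoint (SComplex.disjoint_faces hdisj hF.1 hG.1),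
      card_union_of_disjoint (SComplex.disjoint_faces hdisj hF'.1 hG'.1),
      hCM.card_eq_of_isFacet hF, hCM.card_eq_of_isFacet hF', hCMt.1 hG hG']
  · rintro _ ⟨F, hF, G, hG, rfl⟩ hcard
    have hF' := SComplex.card_le_dimSucc hF
    have hle := card_union_le F G
    rw [SComplex.link_join hdisj hF hG]
    exact (hCM.link hF).join (hCMt.2 G hG (by omega))
      (SComplex.disjoint_vertexSet_link hdisj F G)
  · obtain ⟨F, hF, hFc⟩ := SComplex.exists_card_eq_dimSucc (SComplex.isCM_iff.mp hCM).empty_mem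
    have hcard := card_union_of_disjoint (SComplex.disjoint_faces hdisj hF hG)
    have hlink := h.2 (F ∪ G) ⟨F, hF, G, hG, rfl⟩ (by omega)
    have heq : (Δ₁.link F).join (Δ₂.link G) = Δ₂.link G := by
      refine SComplex.eq_of_mem_iff fun H => ?_
      have hF_link {F' : Finset V} (h : F' ∈ (Δ₁.link F).faces) : F' = ∅ := by
        rw [SComplex.mem_link] at h
        have := SComplex.card_le_dimSucc h.2
        rw [card_union_of_disjoint h.1] at this
        exact card_eq_zero.mp (by omega)
      constructor
      · rintro ⟨F', hF', G', hG', rfl⟩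
        rwa [hF_link hF', empty_union]
      · intro hH
        refine ⟨∅, ?_, H, hH, (empty_union H).symm⟩
        simpa [SComplex.mem_link] using hF
    rwa [SComplex.link_join hdisj hF hG, heq] at hlink
end

section
/- Let d ≥ 2, let u ≥ v be squarefree monomials of degree d in k[x₁,…,xₙ] with u = x_i x_{i₂} ⋯ x_{i_d}, i < i₂ < ⋯ < i_d, let Δ be the simplicial complex on [n] with I_Δ = (L(u,v)), and let Δ₂ be the simplicial complex of the lexsegment ideal generated by L(u,v) regarded as an ideal of k[x_i,…,xₙ]. Then Δ is Cohen-Macaulay over k if and only if Δ₂ is Cohen-Macaulay over k. -/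
open Finset

section GroundSet

/-- The squarefree monomial `∏_{i ∈ S} xᵢ` in the polynomial ring whose
variables are indexed by the ground set `W ⊆ ℕ`. -/
noncomputable def monoW (k : Type*) [CommRing k] (W S : Finset ℕ) :
    MvPolynomial {x // x ∈ W} k :=
  ∏ i ∈ S.subtype (· ∈ W), MvPolynomial.X i

/-- The Stanley–Reisner ideal of a complex `Δ` with ground (vertex) set `W ⊆ ℕ`,
inside the polynomial ring `k[xᵢ : i ∈ W]`: it is generated by the squarefree
monomials of the non-faces contained in `W`. -/
noncomputable def srIdealW (k : Type*) [CommRing k] (W : Finset ℕ) (Δ : SComplex ℕ) :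
    Ideal (MvPolynomial {x // x ∈ W} k) :=
  Ideal.span {p | ∃ F : Finset ℕ, F ⊆ W ∧ F ∉ Δ.faces ∧ p = monoW k W F}

/-- The Stanley–Reisner ring `k[Δ]` of a complex with ground set `W ⊆ ℕ`. -/
abbrev srRingW (k : Type*) [CommRing k] (W : Finset ℕ) (Δ : SComplex ℕ) :=
  MvPolynomial {x // x ∈ W} k ⧸ srIdealW k W Δ

/-- The irrelevant maximal ideal of the Stanley–Reisner ring. -/
noncomputable def srIrrelevantW (k : Type*) [CommRing k] (W : Finset ℕ)
    (Δ : SComplex ℕ) : Ideal (srRingW k W Δ) :=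
  (Ideal.span (Set.range (MvPolynomial.X : {x // x ∈ W} → MvPolynomial {x // x ∈ W} k))).map
    (Ideal.Quotient.mk (srIdealW k W Δ))

/-- `Δ` (a complex with ground set `W ⊆ ℕ`) is Cohen–Macaulay over the field `k`:
the ring `k[Δ]` admits a regular sequence, inside the irrelevant maximal ideal,
whose length equals the Krull dimension of `k[Δ]`. -/
def IsCMW (k : Type*) [Field k] (W : Finset ℕ) (Δ : SComplex ℕ) : Prop :=
  ∃ rs : List (srRingW k W Δ), (∀ r ∈ rs, r ∈ srIrrelevantW k W Δ) ∧
    RingTheory.Sequence.IsRegular (srRingW k W Δ) rs ∧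
    ringKrullDim (srRingW k W Δ) = (rs.length : WithBot ℕ∞)

/-- `Δ` is `CM_t` (Cohen–Macaulay in codimension `t`) over `k`: `Δ` is pure and
`link_Δ(F)` is Cohen–Macaulay over `k` for every face `F` with `#F ≥ t`.
`CM_1` is the Buchsbaum property. -/
def IsCMtW (k : Type*) [Field k] (W : Finset ℕ) (t : ℕ) (Δ : SComplex ℕ) : Prop :=
  Δ.Pure ∧ ∀ F ∈ Δ.faces, t ≤ F.card → IsCMW k W (Δ.link F)

end GroundSet

section Lex

/-- Comparison of squarefree monomials of the same degree in the lexicographic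
order with `x₁ > x₂ > ⋯ > xₙ`, the monomials being identified with their
supports: `u >_lex v` iff the smallest variable index where they differ
belongs to `u`. -/
def lexGT (A B : Finset ℕ) : Prop :=
  ∃ m ∈ A, m ∉ B ∧ ∀ x < m, (x ∈ A ↔ x ∈ B)

/-- `u ≥_lex v` for squarefree monomials identified with their supports. -/
def lexGE (A B : Finset ℕ) : Prop := A = B ∨ lexGT A B

/-- The lexsegment `L(u,v)` of squarefree monomials of degree `d` in
`x₁, …, xₙ`, the monomials being identified with their supports:
all `S ⊆ [n] = {1, …, n}` with `#S = d` and `u ≥_lex S ≥_lex v`. -/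
def lexSegment (n d : ℕ) (U V₀ : Finset ℕ) : Set (Finset ℕ) :=
  {S | S ⊆ Finset.Icc 1 n ∧ S.card = d ∧ lexGE U S ∧ lexGE S V₀}

/-- The ideal of `k[xᵢ : i ∈ W]` generated by the squarefree monomials of the
lexsegment `L(u,v)` (of degree-`d` squarefree monomials in `x₁, …, xₙ`). -/
noncomputable def lexIdealW (k : Type*) [CommRing k] (W : Finset ℕ) (n d : ℕ)
    (U V₀ : Finset ℕ) : Ideal (MvPolynomial {x // x ∈ W} k) :=
  Ideal.span {p | ∃ S ∈ lexSegment n d U V₀, p = monoW k W S}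

end Lex

section CohenMacaulayAt

open RingTheory.Sequence CategoryTheory Abelian Pointwise

lemma Ideal.smul_top_quotSMulTop_ne_top {R M : Type*} [CommRing R] [AddCommGroup M] [Module R M]
    {I : Ideal R} {r : R} (hr : r ∈ I) (hI : I • (⊤ : Submodule R M) ≠ ⊤) :
    I • (⊤ : Submodule R (QuotSMulTop r M)) ≠ ⊤ := by
  intro h
  replace h := congrArg (Submodule.comap (Submodule.mkQ _)) h
  exact hI (by simpa [Submodule.comap_smul_top_of_surjective I _ (Submodule.mkQ_surjective _),
    Submodule.smul_mono_left ((Ideal.span_singleton_le_iff_mem I).mpr hr),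
    ← Submodule.ideal_span_singleton_smul] using h)

/-- Modding out a regular element of `I` lowers the length of regular sequences in `I`
by at most one. -/
lemma IsSMulRegular.exists_isRegular_quotSMulTop.{u} {R : Type u} [CommRing R] [IsNoetherianRing R]
    {M : Type u} [AddCommGroup M] [Module R M] [Module.Finite R M] {I : Ideal R}
    (hI : I • (⊤ : Submodule R M) ≠ ⊤) {y : R} (hy : y ∈ I) (hreg : IsSMulRegular M y)
    {rs : List R} (hmem : ∀ r ∈ rs, r ∈ I) (hrs : IsRegular M rs) {n : ℕ}
    (hn : rs.length = n + 1) :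
    ∃ rs' : List R, rs'.length = n ∧ (∀ r ∈ rs', r ∈ I) ∧ IsRegular (QuotSMulTop y M) rs' := by
  have htfae (N : Type u) [AddCommGroup N] [Module R N] [Module.Finite R N]
      (hN : I • (⊤ : Submodule R N) ≠ ⊤) (l : ℕ) := (ModuleCat.exists_isRegular_tfae I l
    (ModuleCat.of R N) hN.lt_top).out 1 3
  have hExt := (htfae M hI (n + 1)).2 ⟨rs, hn, hmem, hrs⟩
  refine (htfae (QuotSMulTop y M) (Ideal.smul_top_quotSMulTop_ne_top hy hI) n).1 fun i hi ↦ ?_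
  have h₁ := AddCommGrpCat.isZero_of_iff_subsingleton.mpr (hExt i (by omega))
  have h₂ := AddCommGrpCat.isZero_of_iff_subsingleton.mpr (hExt (i + 1) (by omega))
  exact AddCommGrpCat.subsingleton_of_isZero <| ShortComplex.Exact.isZero_of_both_zeros
    (Ext.covariant_sequence_exact₃' _
      (IsSMulRegular.smulShortComplex_shortExact (M := ModuleCat.of R M) hreg) i (i + 1) rfl)
    (h₁.eq_zero_of_src _) (h₂.eq_zero_of_tgt _)

/-- `R` has a regular sequence inside the ideal `I` of length equal to the Krull dimension. -/
def Ideal.IsCMAt {R : Type*} [CommRing R] (I : Ideal R) : Prop :=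
  ∃ rs : List R, (∀ r ∈ rs, r ∈ I) ∧ IsRegular R rs ∧ ringKrullDim R = (rs.length : WithBot ℕ∞)

lemma Ideal.isCMAt_comap_ringEquiv {A B : Type*} [CommRing A] [CommRing B] (e : A ≃+* B)
    (I : Ideal B) : (I.comap (e : A →+* B)).IsCMAt ↔ I.IsCMAt := by
  have key : ∀ rs : List A, IsRegular A rs ↔ IsRegular B (rs.map e) := fun rs ↦
    e.toAddEquiv.isRegular_congr <| List.forall₂_map_right_iff.mpr <|
      List.forall₂_same.mpr fun r _ x ↦ map_mul e r x
  constructor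
  · rintro ⟨rs, hmem, hrs, hdim⟩
    refine ⟨rs.map e, by simpa using hmem, (key rs).1 hrs, ?_⟩
    rw [← ringKrullDim_eq_of_ringEquiv e, hdim, List.length_map]
  · rintro ⟨rs, hmem, hrs, hdim⟩
    refine ⟨rs.map e.symm, by simpa using hmem,
      (key _).2 (by simpa [Function.comp_def] using hrs), ?_⟩
    rw [ringKrullDim_eq_of_ringEquiv e, hdim, List.length_map]

/-- Regular sequences on `A ⧸ x A`, where `x` generates the kernel of `f : A → B`, are those
mapped by `f` to regular sequences on `B`. -/
lemma isRegular_quotSMulTop_iff_map {A B : Type*} [CommRing A] [CommRing B] {f : A →+* B}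
    (hf : Function.Surjective f) {x : A} (hx : RingHom.ker f = Ideal.span {x}) (rs : List A) :
    IsRegular (QuotSMulTop x A) rs ↔ IsRegular B (rs.map f) := by
  have hker : (x • (⊤ : Submodule A A)) = RingHom.ker f := by
    rw [hx, ← Submodule.ideal_span_singleton_smul]; simp
  let g : A →ₛₗ[f] B := { toFun := f, map_add' := map_add f, map_smul' := fun a b ↦ map_mul f a b }
  let h : QuotSMulTop x A →ₛₗ[f] B := Submodule.liftQ _ g (by rw [hker]; exact fun a ha ↦ ha)
  have hbij : Function.Bijective h := by
    constructor
    · refine (injective_iff_map_eq_zero h).2 fun a ↦ ?_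
      obtain ⟨a, rfl⟩ := Submodule.mkQ_surjective _ a
      intro ha
      exact (Submodule.Quotient.mk_eq_zero _).2 (by rw [hker]; exact ha)
    · intro b
      obtain ⟨a, rfl⟩ := hf b
      exact ⟨Submodule.Quotient.mk a, rfl⟩
  exact (AddEquiv.ofBijective h.toAddMonoidHom hbij).isRegular_congr <|
    List.forall₂_map_right_iff.mpr <| List.forall₂_same.mpr fun r _ y ↦ h.map_smulₛₗ r y

/-- Cohen-Macaulayness passes to and from the quotient by a regular element. -/
lemma Ideal.isCMAt_comap_iff {A B : Type*} [CommRing A] [IsNoetherianRing A] [CommRing B]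
    {f : A →+* B} (hf : Function.Surjective f) {x : A} (hker : RingHom.ker f = Ideal.span {x})
    (hx : IsSMulRegular A x) (hdim : ringKrullDim A = ringKrullDim B + 1)
    {I : Ideal B} (hI : I ≠ ⊤) : (I.comap f).IsCMAt ↔ I.IsCMAt := by
  have hxf : f x = 0 := by
    rw [← RingHom.mem_ker, hker]; exact Ideal.mem_span_singleton_self x
  have hxI : x ∈ I.comap f := by simp [hxf]
  have : Nontrivial B := by
    by_contra h
    rw [not_nontrivial_iff_subsingleton] at h
    exact hI (Subsingleton.elim _ _)
  constructor
  · rintro ⟨rs, hmem, hrs, hd⟩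
    rw [hdim] at hd
    obtain ⟨n, hn⟩ : ∃ n : ℕ, ringKrullDim B = n := by
      induction h : ringKrullDim B with
      | bot => simp [h] at hd
      | coe m =>
        induction m with
        | top => exact absurd (WithBot.coe_inj.1 (h ▸ hd)) (by simp)
        | coe m => exact ⟨m, rfl⟩
    rw [hn] at hd
    obtain ⟨rs', hlen, hmem', hrs'⟩ := hx.exists_isRegular_quotSMulTop
      (I := I.comap f) (by simpa using Ideal.comap_ne_top f hI) hxI hmem hrs (n := n)
      (by exact_mod_cast hd.symm)
    exact ⟨rs'.map f, by simpa using hmem', (isRegular_quotSMulTop_iff_map hf hker _).1 hrs',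
      by rw [hn, List.length_map, hlen]⟩
  · rintro ⟨rs, hmem, hrs, hd⟩
    obtain ⟨rs, rfl⟩ := hf.list_map rs
    refine ⟨x :: rs, ?_, .cons hx ((isRegular_quotSMulTop_iff_map hf hker _).2 hrs), ?_⟩
    · simpa [hxf] using hmem
    · rw [hdim, hd]; simp

lemma Polynomial.isCMAt_comap_constantCoeff {R : Type*} [CommRing R] [IsNoetherianRing R]
    {I : Ideal R} (hI : I ≠ ⊤) : (I.comap (Polynomial.constantCoeff (R := R))).IsCMAt ↔ I.IsCMAt :=
  Ideal.isCMAt_comap_iff (x := Polynomial.X) Polynomial.constantCoeff_surjective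
    (by ext p; simp [Ideal.mem_span_singleton, Polynomial.X_dvd_iff])
    Polynomial.isRegular_X.left.isSMulRegular Polynomial.ringKrullDim_of_isNoetherianRing hI

lemma MvPolynomial.isCMAt_comap_constantCoeff {R σ : Type*} [CommRing R] [IsNoetherianRing R]
    [Finite σ] {I : Ideal R} (hI : I ≠ ⊤) :
    (I.comap (MvPolynomial.constantCoeff (σ := σ))).IsCMAt ↔ I.IsCMAt := by
  induction σ using Finite.induction_empty_option with
  | of_equiv e H =>
    rw [← H, ← Ideal.isCMAt_comap_ringEquiv (renameEquiv R e).toRingEquiv, Ideal.comap_comap]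
    congr! 2
    ext <;> simp
  | h_empty =>
    rw [← Ideal.isCMAt_comap_ringEquiv (isEmptyRingEquiv R PEmpty)]
    congr! 2
  | @h_option σ _ H =>
    refine Iff.trans ?_ ((Ideal.isCMAt_comap_ringEquiv (optionEquivLeft R σ).toRingEquiv _).trans
      ((Polynomial.isCMAt_comap_constantCoeff (Ideal.comap_ne_top _ hI)).trans H))
    rw [Ideal.comap_comap, Ideal.comap_comap]
    congr! 2
    ext i
    · simp
    · cases i <;> simp

lemma MvPolynomial.span_range_X_eq_ker {k σ : Type*} [CommRing k] :
    Ideal.span (Set.range (X : σ → MvPolynomial σ k)) = RingHom.ker constantCoeff := by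
  ext p
  rw [← Set.image_univ, mem_ideal_span_X_image, RingHom.mem_ker, constantCoeff_eq]
  constructor
  · intro h
    by_contra hp
    obtain ⟨i, -, hi⟩ := h 0 (mem_support_iff.2 hp)
    exact hi rfl
  · intro hp m hm
    have : m ≠ 0 := by rintro rfl; exact mem_support_iff.1 hm hp
    obtain ⟨i, hi⟩ := Finsupp.ne_iff.1 this
    exact ⟨i, trivial, hi⟩

/-- Adjoining variables to `k[ρ] ⧸ J` preserves Cohen-Macaulayness at the irrelevant ideal. -/
lemma MvPolynomial.isCMAt_map_rename_iff {k ρ τ : Type*} [Field k] [Finite τ]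
    {j : ρ → τ} (hj : Function.Injective j) {J : Ideal (MvPolynomial ρ k)}
    (hJ : J ≤ RingHom.ker constantCoeff)
    {J' : Ideal (MvPolynomial τ k)}
    (hJ' : J' = J.map (rename (R := k) j).toRingHom) :
    ((Ideal.span (Set.range X)).map (Ideal.Quotient.mk J')).IsCMAt ↔
      ((Ideal.span (Set.range X)).map (Ideal.Quotient.mk J)).IsCMAt := by
  have := Finite.of_injective j hj
  classical
  let σ := ((Set.range j)ᶜ : Set τ)
  let e : σ ⊕ ρ ≃ τ := (Equiv.sumComm _ _).trans <|
    ((Equiv.ofInjective j hj).sumCongr (Equiv.refl σ)).trans (Equiv.Set.sumCompl _)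
  have he (r : ρ) : e (Sum.inr r) = j r := rfl
  have he' (r : ρ) : e.symm (j r) = Sum.inr r := by rw [← he, e.symm_apply_apply]
  have hJ'k : J' ≤ RingHom.ker constantCoeff := by
    rw [hJ', Ideal.map_le_iff_le_comap]
    intro p hp
    simpa [constantCoeff_rename] using hJ hp
  let ψ : MvPolynomial τ k ≃+* MvPolynomial σ (MvPolynomial ρ k) :=
    (renameEquiv k e.symm).toRingEquiv.trans (sumRingEquiv k σ ρ)
  have hψ : J.map C = J'.map (ψ : MvPolynomial τ k →+* MvPolynomial σ (MvPolynomial ρ k)) := by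
    rw [hJ', Ideal.map_map]
    congr 1
    ext <;> simp [ψ, he']
  let φ : (MvPolynomial τ k ⧸ J') ≃+* MvPolynomial σ (MvPolynomial ρ k ⧸ J) :=
    (Ideal.quotientEquiv J' (J.map C) ψ hψ).trans
      (quotientEquivQuotientMvPolynomial (σ := σ) J).symm.toRingEquiv
  have hI : (Ideal.span (Set.range X)).map (Ideal.Quotient.mk J) ≠ ⊤ := by
    rw [span_range_X_eq_ker, ← Ideal.ker_quotient_lift _ hJ]
    exact RingHom.ker_ne_top _
  refine Iff.trans ?_ ((Ideal.isCMAt_comap_ringEquiv φ _).trans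
    (MvPolynomial.isCMAt_comap_constantCoeff hI))
  rw [span_range_X_eq_ker, span_range_X_eq_ker, ← Ideal.ker_quotient_lift _ hJ,
    ← Ideal.ker_quotient_lift _ hJ'k, RingHom.comap_ker, RingHom.comap_ker]
  congr! 2
  have hφ (p : MvPolynomial τ k) : φ (Ideal.Quotient.mk J' p) =
      eval₂Hom (C.comp (Ideal.Quotient.mk J)) X (ψ p) := rfl
  have hlift (p : MvPolynomial ρ k) :
      Ideal.Quotient.lift J constantCoeff hJ (Ideal.Quotient.mk J p) = constantCoeff p := rfl
  have hlift' (p : MvPolynomial τ k) :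
      Ideal.Quotient.lift J' constantCoeff hJ'k (Ideal.Quotient.mk J' p) = constantCoeff p := rfl
  refine Ideal.Quotient.ringHom_ext (MvPolynomial.ringHom_ext (fun r ↦ ?_) fun t ↦ ?_)
  · simp [hφ, ψ, hlift, hlift']
  · obtain ⟨s | r, rfl⟩ := e.surjective t
    · simp [hφ, ψ, hlift']
    · simp [hφ, ψ, hlift, hlift']

end CohenMacaulayAt

lemma subset_Icc_of_mem_lexSegment {n d i : ℕ} {U V₀ S : Finset ℕ} (himin : ∀ m ∈ U, i ≤ m)
    (hS : S ∈ lexSegment n d U V₀) : S ⊆ Finset.Icc i n := by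
  obtain ⟨hSn, -, hUS, -⟩ := hS
  intro x hx
  refine Finset.mem_Icc.2 ⟨?_, (Finset.mem_Icc.1 (hSn hx)).2⟩
  rcases hUS with rfl | ⟨m, hmU, -, hm⟩
  · exact himin x hx
  · by_contra! hxi
    have := himin m hmU
    exact hxi.not_ge (himin x ((hm x (by omega)).2 hx))

lemma rename_monoW (k : Type*) [CommRing k] {W W' S : Finset ℕ} (hW : W' ⊆ W) (hS : S ⊆ W') :
    MvPolynomial.rename (fun x : {x // x ∈ W'} ↦ (⟨x, hW x.2⟩ : {x // x ∈ W})) (monoW k W' S) =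
      monoW k W S := by
  have : S.subtype (· ∈ W) = (S.subtype (· ∈ W')).map (Subtype.impEmbedding _ _ fun _ h ↦ hW h) := by
    ext x
    simp only [Finset.mem_subtype, Finset.mem_map, Subtype.exists]
    exact ⟨fun h ↦ ⟨x, hS h, h, rfl⟩, by rintro ⟨y, -, hy, rfl⟩; exact hy⟩
  rw [monoW, monoW, this, Finset.prod_map, map_prod]
  exact Finset.prod_congr rfl fun x _ ↦ MvPolynomial.rename_X _ _

lemma constantCoeff_monoW (k : Type*) [CommRing k] {W S : Finset ℕ} (hS : S ⊆ W)
    (hne : S.Nonempty) : MvPolynomial.constantCoeff (monoW k W S) = 0 := by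
  obtain ⟨x, hx⟩ := hne
  rw [monoW, map_prod]
  exact Finset.prod_eq_zero (i := ⟨x, hS hx⟩) (Finset.mem_subtype.2 hx)
    (MvPolynomial.constantCoeff_X k _)

lemma lexIdealW_eq_map_rename (k : Type*) [CommRing k] {W W' : Finset ℕ} {n d : ℕ}
    {U V₀ : Finset ℕ} (hW : W' ⊆ W) (hL : ∀ S ∈ lexSegment n d U V₀, S ⊆ W') :
    lexIdealW k W n d U V₀ = (lexIdealW k W' n d U V₀).map (MvPolynomial.rename (R := k)
      (fun x : {x // x ∈ W'} ↦ (⟨x, hW x.2⟩ : {x // x ∈ W}))).toRingHom := by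
  rw [lexIdealW, lexIdealW, Ideal.map_span]
  congr 1
  ext p
  constructor
  · rintro ⟨S, hS, rfl⟩
    exact ⟨_, ⟨S, hS, rfl⟩, rename_monoW k hW (hL S hS)⟩
  · rintro ⟨_, ⟨S, hS, rfl⟩, rfl⟩
    exact ⟨S, hS, rename_monoW k hW (hL S hS)⟩

lemma lexIdealW_le_ker (k : Type*) [CommRing k] {W : Finset ℕ} {n d : ℕ} (hd : d ≠ 0)
    {U V₀ : Finset ℕ} (hL : ∀ S ∈ lexSegment n d U V₀, S ⊆ W) :
    lexIdealW k W n d U V₀ ≤ RingHom.ker MvPolynomial.constantCoeff := by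
  refine Ideal.span_le.2 ?_
  rintro _ ⟨S, hS, rfl⟩
  exact constantCoeff_monoW k (hL S hS) (Finset.card_ne_zero.1 (by rwa [hS.2.1]))

/-- In the lexsegment setting, `Δ` is Cohen–Macaulay over `k`
iff `Δ₂` is Cohen–Macaulay over `k`. -/
theorem lexsegment_isCM_iff (k : Type*) [Field k] (n d i : ℕ) (hd : 2 ≤ d)
    (U V₀ : Finset ℕ) (hUsub : U ⊆ Finset.Icc 1 n) (hVsub : V₀ ⊆ Finset.Icc 1 n)
    (hUcard : U.card = d) (hVcard : V₀.card = d) (huv : lexGE U V₀)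
    (hiU : i ∈ U) (himin : ∀ m ∈ U, i ≤ m)
    (Δ : SComplex ℕ) (hΔsub : ∀ F ∈ Δ.faces, F ⊆ Finset.Icc 1 n)
    (hΔ : srIdealW k (Finset.Icc 1 n) Δ = lexIdealW k (Finset.Icc 1 n) n d U V₀)
    (Δ₂ : SComplex ℕ) (hΔ₂sub : ∀ F ∈ Δ₂.faces, F ⊆ Finset.Icc i n)
    (hΔ₂ : srIdealW k (Finset.Icc i n) Δ₂ = lexIdealW k (Finset.Icc i n) n d U V₀) :
    IsCMW k (Finset.Icc 1 n) Δ ↔ IsCMW k (Finset.Icc i n) Δ₂ := by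
  have hL := fun S (hS : S ∈ lexSegment n d U V₀) ↦ subset_Icc_of_mem_lexSegment himin hS
  have hsub : Finset.Icc i n ⊆ Finset.Icc 1 n :=
    Finset.Icc_subset_Icc_left (Finset.mem_Icc.1 (hUsub hiU)).1
  refine MvPolynomial.isCMAt_map_rename_iff
    (j := fun x : {x // x ∈ Finset.Icc i n} ↦ (⟨x, hsub x.2⟩ : {x // x ∈ Finset.Icc 1 n}))
    (fun x y h ↦ Subtype.ext (congrArg (fun z ↦ z.1) h)) ?_ ?_
  · rw [hΔ₂]
    exact lexIdealW_le_ker k (by omega) hL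
  · rw [hΔ, hΔ₂]
    exact lexIdealW_eq_map_rename k hsub hL
end
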